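/- Liouville theorem on a complete Monge–Ampère Hessian manifold: suppose u solves the weighted Monge–Ampère equation, φ := (1/2)(u_{,p} ξ^p + v_q x^q), the Hessian metric g is complete on N, and F : N → ℝ is a smooth nonnegative function satisfying Δ_φ F ≥ F² at every point of N. Then F is identically zero on N. -/

import Mathlib

open scoped BigOperators
noncomputable section

namespace KRS

variable {n : ℕ}

/-- Partial derivative of `f` in the `i`-th coordinate direction. -/
def pd (i : Fin n) (f : (Fin n → ℝ) → ℝ) : (Fin n → ℝ) → ℝ :=
  fun x => fderiv ℝ f x (Pi.single i 1)

/-- The Hessian matrix `g(x)` of `u`, with entries `g_{ij} = ∂²u/∂x^i∂x^j`. -/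
def hessian (u : (Fin n → ℝ) → ℝ) (x : Fin n → ℝ) : Matrix (Fin n) (Fin n) ℝ :=
  Matrix.of fun i j => pd i (pd j u) x

/-- The inverse matrix `g(x)⁻¹`, with entries `g^{ij}`. -/
def ginv (u : (Fin n → ℝ) → ℝ) (x : Fin n → ℝ) : Matrix (Fin n) (Fin n) ℝ :=
  (hessian u x)⁻¹

/-- Third iterated partial derivative `u_{,ijk}`. -/
def d3 (u : (Fin n → ℝ) → ℝ) (i j k : Fin n) : (Fin n → ℝ) → ℝ :=
  pd i (pd j (pd k u))

/-- Fourth iterated partial derivative `u_{,ijkl}`. -/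
def d4 (u : (Fin n → ℝ) → ℝ) (i j k l : Fin n) : (Fin n → ℝ) → ℝ :=
  pd i (pd j (pd k (pd l u)))

/-- Christoffel symbols `Γ^k_{ij} = (1/2) g^{kl}(∂_i g_{jl} + ∂_j g_{il} − ∂_l g_{ij})`. -/
def Christoffel (u : (Fin n → ℝ) → ℝ) (k i j : Fin n) : (Fin n → ℝ) → ℝ :=
  fun x => (1/2) * ∑ l, ginv u x k l * (d3 u i j l x + d3 u j i l x - d3 u l i j x)

/-- Riemann curvature tensor
`Rm_{ijkl} = g_{is}(∂_k Γ^s_{lj} − ∂_l Γ^s_{kj} + Γ^s_{kp} Γ^p_{lj} − Γ^s_{lp} Γ^p_{kj})`. -/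
def Rm (u : (Fin n → ℝ) → ℝ) (i j k l : Fin n) : (Fin n → ℝ) → ℝ :=
  fun x => ∑ s, hessian u x i s *
    (pd k (Christoffel u s l j) x - pd l (Christoffel u s k j) x
      + ∑ p, Christoffel u s k p x * Christoffel u p l j x
      - ∑ p, Christoffel u s l p x * Christoffel u p k j x)

/-- Ricci tensor `Ric_{ij} = ∂_k Γ^k_{ij} − ∂_j Γ^k_{ik} + Γ^k_{kp} Γ^p_{ij} − Γ^k_{jp} Γ^p_{ik}`. -/
def Ricci (u : (Fin n → ℝ) → ℝ) (i j : Fin n) : (Fin n → ℝ) → ℝ :=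
  fun x => (∑ k, pd k (Christoffel u k i j) x) - (∑ k, pd j (Christoffel u k i k) x)
    + (∑ k, ∑ p, Christoffel u k k p x * Christoffel u p i j x)
    - (∑ k, ∑ p, Christoffel u k j p x * Christoffel u p i k x)

/-- Scalar curvature `s = g^{ij} Ric_{ij}`. -/
def scalarCurv (u : (Fin n → ℝ) → ℝ) : (Fin n → ℝ) → ℝ :=
  fun x => ∑ i, ∑ j, ginv u x i j * Ricci u i j x

/-- Covariant Hessian `(∇²φ)_{ij} = φ_{,ij} − Γ^k_{ij} φ_{,k}`. -/
def covHess (u φ : (Fin n → ℝ) → ℝ) (i j : Fin n) : (Fin n → ℝ) → ℝ :=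
  fun x => pd i (pd j φ) x - ∑ k, Christoffel u k i j x * pd k φ x

/-- Laplace–Beltrami operator `Δφ = g^{ij} (∇²φ)_{ij}`. -/
def laplacian (u φ : (Fin n → ℝ) → ℝ) : (Fin n → ℝ) → ℝ :=
  fun x => ∑ i, ∑ j, ginv u x i j * covHess u φ i j x

/-- Weighted (drift) Laplacian `Δ_φ F = ΔF − g^{ij} φ_{,i} F_{,j}`. -/
def driftLap (u φ F : (Fin n → ℝ) → ℝ) : (Fin n → ℝ) → ℝ :=
  fun x => laplacian u F x - ∑ i, ∑ j, ginv u x i j * pd i φ x * pd j F x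

/-- Bakry–Émery Ricci tensor `(Ric_φ)_{ij} = Ric_{ij} + (∇²φ)_{ij}`. -/
def ricciPhi (u φ : (Fin n → ℝ) → ℝ) (i j : Fin n) : (Fin n → ℝ) → ℝ :=
  fun x => Ricci u i j x + covHess u φ i j x

/-- Pointwise squared `g`-norm of the third derivative tensor:
`|u_{,ijk}|²_g = g^{ip} g^{jq} g^{kr} u_{,ijk} u_{,pqr}`. -/
def norm3 (u : (Fin n → ℝ) → ℝ) : (Fin n → ℝ) → ℝ :=
  fun x => ∑ i, ∑ j, ∑ k, ∑ p, ∑ q, ∑ r,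
    ginv u x i p * ginv u x j q * ginv u x k r * d3 u i j k x * d3 u p q r x

/-- The canonical weight function `φ = (1/2)(u_{,p} ξ^p + v_q x^q)`. -/
def weight (u : (Fin n → ℝ) → ℝ) (ξ v : Fin n → ℝ) : (Fin n → ℝ) → ℝ :=
  fun x => (1/2) * ((∑ p, pd p u x * ξ p) + ∑ q, v q * x q)

/-- `u` solves the weighted Monge–Ampère equation
`log det g(x) = −v_p x^p + u_{,q}(x) ξ^q + c` on `N`. -/
def MAeq (u : (Fin n → ℝ) → ℝ) (N : Set (Fin n → ℝ)) (v ξ : Fin n → ℝ) (c : ℝ) : Prop :=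
  ∀ x ∈ N, Real.log (hessian u x).det = -(∑ p, v p * x p) + (∑ q, pd q u x * ξ q) + c

/-- Covariant derivative of the third derivative tensor:
`(∇T)_{lijk} = u_{,ijkl} − Γ^s_{li} u_{,sjk} − Γ^s_{lj} u_{,isk} − Γ^s_{lk} u_{,ijs}`. -/
def covT (u : (Fin n → ℝ) → ℝ) (l i j k : Fin n) : (Fin n → ℝ) → ℝ :=
  fun x => d4 u i j k l x - (∑ s, Christoffel u s l i x * d3 u s j k x)
    - (∑ s, Christoffel u s l j x * d3 u i s k x)
    - (∑ s, Christoffel u s l k x * d3 u i j s x)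

/-- Completeness of the Hessian metric `g = D²u` on `N`: every C¹ curve
`γ : [0,1) → N` that eventually leaves every compact subset of `N`
has infinite `g`-length. -/
def HessComplete (u : (Fin n → ℝ) → ℝ) (N : Set (Fin n → ℝ)) : Prop :=
  ∀ γ : ℝ → (Fin n → ℝ),
    ContDiffOn ℝ 1 γ (Set.Ico (0:ℝ) 1) →
    (∀ t ∈ Set.Ico (0:ℝ) 1, γ t ∈ N) →
    (∀ K : Set (Fin n → ℝ), IsCompact K → K ⊆ N →
      ∃ tK ∈ Set.Ico (0:ℝ) 1, ∀ t ∈ Set.Ioo tK 1, γ t ∉ K) →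
    ∫⁻ t in Set.Ioo (0:ℝ) 1,
      ENNReal.ofReal (Real.sqrt (∑ i, ∑ j,
        hessian u (γ t) i j * deriv γ t i * deriv γ t j)) = ⊤

open Matrix Filter Topology

section Calculus

variable {N : Set (Fin n → ℝ)} {f u : (Fin n → ℝ) → ℝ}

lemma contDiffOn_pd (hN : IsOpen N) (hf : ContDiffOn ℝ (⊤ : ℕ∞) f N) (i : Fin n) :
    ContDiffOn ℝ (⊤ : ℕ∞) (pd i f) N :=
  (hf.fderiv_of_isOpen hN (m := (⊤ : ℕ∞)) (by simp)).clm_apply contDiffOn_const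

lemma differentiableAt_of_contDiffOn (hN : IsOpen N) (hf : ContDiffOn ℝ (⊤ : ℕ∞) f N)
    {x : Fin n → ℝ} (hx : x ∈ N) : DifferentiableAt ℝ f x :=
  ((hf x hx).contDiffAt (hN.mem_nhds hx)).differentiableAt (by simp)

lemma fderiv_eq_sum_pd (x w : Fin n → ℝ) : fderiv ℝ f x w = ∑ i, w i * pd i f x := by
  conv_lhs => rw [← Finset.univ_sum_single w, map_sum]
  refine Finset.sum_congr rfl fun i _ => ?_
  have : (Pi.single i (w i) : Fin n → ℝ) = w i • Pi.single i 1 := by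
    rw [← Pi.single_smul]; simp
  rw [this, map_smul, smul_eq_mul, pd]

lemma pd_comm (hN : IsOpen N) (hf : ContDiffOn ℝ (⊤ : ℕ∞) f N) {x : Fin n → ℝ} (hx : x ∈ N)
    (i j : Fin n) : pd i (pd j f) x = pd j (pd i f) x := by
  have hat : ContDiffAt ℝ (⊤ : ℕ∞) f x := (hf x hx).contDiffAt (hN.mem_nhds hx)
  have two_le : (1 + 1 : WithTop ℕ∞) ≤ ((⊤ : ℕ∞) : WithTop ℕ∞) :=
    WithTop.coe_le_coe.2 (le_top : (1 + 1 : ℕ∞) ≤ ⊤)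
  have hd : DifferentiableAt ℝ (fderiv ℝ f) x :=
    (hat.fderiv_right (m := 1) two_le).differentiableAt (by simp)
  have key : ∀ a b : Fin n, pd a (pd b f) x
      = fderiv ℝ (fderiv ℝ f) x (Pi.single a 1) (Pi.single b 1) := by
    intro a b
    have hp : pd b f = fun y => fderiv ℝ f y (Pi.single b 1) := rfl
    rw [pd, hp, fderiv_clm_apply hd (differentiableAt_const _)]
    simp
  rw [key, key]
  exact (hat.isSymmSndFDerivAt (by simpa [one_add_one_eq_two] using two_le)) _ _

lemma hasDerivAt_line (hN : IsOpen N) (hf : ContDiffOn ℝ (⊤ : ℕ∞) f N) (x w : Fin n → ℝ) {t : ℝ}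
    (hx : x + t • w ∈ N) :
    HasDerivAt (fun s : ℝ => f (x + s • w)) (∑ i, w i * pd i f (x + t • w)) t := by
  have h1 := (differentiableAt_of_contDiffOn hN hf hx).hasFDerivAt
  have h2 : HasDerivAt (fun s : ℝ => x + s • w) w t := by
    simpa using ((hasDerivAt_id t).smul_const w).const_add x
  have := h1.comp_hasDerivAt t h2
  rwa [fderiv_eq_sum_pd] at this

lemma hessian_symm (hN : IsOpen N) (hu : ContDiffOn ℝ (⊤ : ℕ∞) u N) {x : Fin n → ℝ} (hx : x ∈ N)
    (i j : Fin n) : hessian u x i j = hessian u x j i :=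
  pd_comm hN hu hx i j

lemma d3_swap_right (hN : IsOpen N) (hu : ContDiffOn ℝ (⊤ : ℕ∞) u N) {x : Fin n → ℝ} (hx : x ∈ N)
    (i j k : Fin n) : d3 u i j k x = d3 u i k j x := by
  have : pd j (pd k u) =ᶠ[𝓝 x] pd k (pd j u) :=
    Filter.eventually_of_mem (hN.mem_nhds hx) fun y hy => pd_comm hN hu hy j k
  exact congrArg (fun L => L (Pi.single i 1)) (this.fderiv_eq (𝕜 := ℝ))

lemma d3_swap_left (hN : IsOpen N) (hu : ContDiffOn ℝ (⊤ : ℕ∞) u N) {x : Fin n → ℝ} (hx : x ∈ N)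
    (i j k : Fin n) : d3 u i j k x = d3 u j i k x :=
  pd_comm hN (contDiffOn_pd hN hu k) hx i j

end Calculus

/-- Jacobi's formula for the derivative of a determinant. -/
lemma hasDerivAt_det {A : ℝ → Matrix (Fin n) (Fin n) ℝ} {A' : Matrix (Fin n) (Fin n) ℝ} {t : ℝ}
    (h : ∀ i j, HasDerivAt (fun s => A s i j) (A' i j) t) :
    HasDerivAt (fun s => (A s).det) (∑ i, ∑ j, (A t).adjugate i j * A' j i) t := by
  have h1 : HasDerivAt (fun s => (A s).det)
      (∑ σ : Equiv.Perm (Fin n), (Equiv.Perm.sign σ : ℝ) *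
        ∑ i, (∏ j ∈ Finset.univ.erase i, A t (σ j) j) • A' (σ i) i) t := by
    simp only [Matrix.det_apply']
    refine HasDerivAt.fun_sum fun σ _ => HasDerivAt.const_mul _ ?_
    exact HasDerivAt.fun_finsetProd fun i _ => h (σ i) i
  convert h1 using 1
  simp only [Finset.mul_sum]
  rw [Finset.sum_comm (s := (Finset.univ : Finset (Equiv.Perm (Fin n))))]
  refine Finset.sum_congr rfl fun i _ => ?_
  have h2 : ∑ j, (A t).adjugate i j * A' j i = ((A t).updateCol i (fun j => A' j i)).det := by
    rw [← Matrix.cramer_apply, Matrix.cramer_eq_adjugate_mulVec]; rfl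
  rw [h2, Matrix.det_apply']
  refine Finset.sum_congr rfl fun σ _ => ?_
  rw [← Finset.mul_prod_erase Finset.univ _ (Finset.mem_univ i)]
  rw [Matrix.updateCol_self, smul_eq_mul]
  rw [mul_comm (A' (σ i) i)]
  congr 2
  refine Finset.prod_congr rfl fun j hj => ?_
  rw [Matrix.updateCol_ne (Finset.ne_of_mem_erase hj)]

section MongeAmpere

variable {N : Set (Fin n → ℝ)} {u : (Fin n → ℝ) → ℝ} {v ξ : Fin n → ℝ} {c : ℝ}

lemma sum_ginv_mul_d3 (hN : IsOpen N) (hu : ContDiffOn ℝ (⊤ : ℕ∞) u N)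
    (hpos : ∀ x ∈ N, (hessian u x).PosDef) (hMA : MAeq u N v ξ c) {x : Fin n → ℝ} (hx : x ∈ N)
    (l : Fin n) :
    ∑ i, ∑ j, ginv u x i j * d3 u l i j x = -v l + ∑ q, hessian u x l q * ξ q := by
  set w : Fin n → ℝ := Pi.single l 1 with hw
  have hxw : x + (0 : ℝ) • w ∈ N := by simpa using hx
  have single : ∀ g : Fin n → ℝ, ∑ i, w i * g i = g l := by
    intro g; simp [hw, Pi.single_apply]
  have line : ∀ {f : (Fin n → ℝ) → ℝ}, ContDiffOn ℝ (⊤ : ℕ∞) f N →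
      HasDerivAt (fun s : ℝ => f (x + s • w)) (pd l f x) 0 := by
    intro f hf
    have := hasDerivAt_line hN hf x w hxw
    simpa [single] using this
  have hdet : HasDerivAt (fun s : ℝ => (hessian u (x + s • w)).det)
      (∑ i, ∑ j, (hessian u x).adjugate i j * d3 u l j i x) 0 := by
    have := hasDerivAt_det (A := fun s : ℝ => hessian u (x + s • w))
      (A' := Matrix.of fun i j => d3 u l i j x) (t := 0)
      (fun i j => line (contDiffOn_pd hN (contDiffOn_pd hN hu j) i))
    simpa using this
  have hdp := (hpos x hx).det_pos
  have hlog := hdet.log (by simpa using hdp.ne')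
  have hright : HasDerivAt (fun s : ℝ => -(∑ p, v p * (x + s • w) p)
      + (∑ q, pd q u (x + s • w) * ξ q) + c) (-v l + ∑ q, hessian u x l q * ξ q) 0 := by
    refine HasDerivAt.add_const _ (HasDerivAt.add ?_ ?_)
    · have : HasDerivAt (fun s : ℝ => ∑ p, v p * (x + s • w) p) (∑ p, v p * w p) 0 := by
        refine HasDerivAt.fun_sum fun p _ => ?_
        have h := (((hasDerivAt_id (0 : ℝ)).mul_const (w p)).const_add (x p)).const_mul (v p)
        simpa using h
      have h2 := this.neg
      have h3 : ∑ p, v p * w p = v l := by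
        rw [← single v]; exact Finset.sum_congr rfl fun _ _ => mul_comm _ _
      rw [h3] at h2
      exact h2
    · refine HasDerivAt.fun_sum fun q _ => ?_
      exact (line (contDiffOn_pd hN hu q)).mul_const (ξ q)
  have hev : (fun s : ℝ => Real.log (hessian u (x + s • w)).det) =ᶠ[𝓝 0]
      (fun s : ℝ => -(∑ p, v p * (x + s • w) p) + (∑ q, pd q u (x + s • w) * ξ q) + c) := by
    have hc : ContinuousAt (fun s : ℝ => x + s • w) 0 := by fun_prop
    filter_upwards [hc.preimage_mem_nhds (hN.mem_nhds hxw)] with s hs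
    exact hMA _ hs
  have := hlog.unique (hright.congr_of_eventuallyEq hev)
  rw [← this]
  simp only [zero_smul, add_zero]
  rw [Finset.sum_div]
  refine Finset.sum_congr rfl fun i _ => ?_
  rw [Finset.sum_div]
  refine Finset.sum_congr rfl fun j _ => ?_
  rw [ginv, Matrix.inv_def, d3_swap_right hN hu hx l i j]
  simp only [Ring.inverse_eq_inv', Matrix.smul_apply, smul_eq_mul]
  ring

lemma hessian_mul_ginv (hpos : ∀ x ∈ N, (hessian u x).PosDef) {x : Fin n → ℝ} (hx : x ∈ N) :
    hessian u x * ginv u x = 1 :=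
  Matrix.mul_nonsing_inv _ ((hpos x hx).det_pos.ne'.isUnit)

lemma ginv_mul_hessian (hpos : ∀ x ∈ N, (hessian u x).PosDef) {x : Fin n → ℝ} (hx : x ∈ N) :
    ginv u x * hessian u x = 1 :=
  Matrix.nonsing_inv_mul _ ((hpos x hx).det_pos.ne'.isUnit)

lemma ginv_symm (hpos : ∀ x ∈ N, (hessian u x).PosDef) {x : Fin n → ℝ} (hx : x ∈ N)
    (i j : Fin n) : ginv u x i j = ginv u x j i := by
  have := (hpos x hx).inv.isHermitian.apply i j
  simpa [ginv] using this.symm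

/-- For a solution of the weighted Monge–Ampère equation the drift Laplacian is the
constant-drift operator `g^{ij} ∂_i ∂_j - ξ^k ∂_k`. -/
lemma driftLap_weight_eq (hN : IsOpen N) (hu : ContDiffOn ℝ (⊤ : ℕ∞) u N)
    (hpos : ∀ x ∈ N, (hessian u x).PosDef) (hMA : MAeq u N v ξ c) {x : Fin n → ℝ} (hx : x ∈ N)
    (F : (Fin n → ℝ) → ℝ) :
    driftLap u (weight u ξ v) F x
      = ∑ i, ∑ j, ginv u x i j * pd i (pd j F) x - ∑ k, ξ k * pd k F x := by
  have hΓ : ∀ k i j, Christoffel u k i j x = (1/2) * ∑ l, ginv u x k l * d3 u l i j x := by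
    intro k i j
    simp only [Christoffel]
    congr 1
    refine Finset.sum_congr rfl fun l _ => ?_
    have e1 : d3 u i j l x = d3 u l i j x := by
      rw [d3_swap_right hN hu hx i j l, d3_swap_left hN hu hx i l j]
    have e2 : d3 u j i l x = d3 u l i j x := by
      rw [d3_swap_left hN hu hx j i l, e1]
    rw [e1, e2]; ring
  have htr : ∀ k, ∑ i, ∑ j, ginv u x i j * Christoffel u k i j x
      = (1/2) * ∑ l, ginv u x k l * (-v l + ∑ q, hessian u x l q * ξ q) := by
    intro k
    simp only [hΓ, ← sum_ginv_mul_d3 hN hu hpos hMA hx, Finset.mul_sum]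
    rw [Finset.sum_congr rfl fun i _ => Finset.sum_comm, Finset.sum_comm]
    refine Finset.sum_congr rfl fun l _ => Finset.sum_congr rfl fun i _ =>
      Finset.sum_congr rfl fun j _ => ?_
    ring
  have hgg : ∀ k, ∑ l, ginv u x k l * ∑ q, hessian u x l q * ξ q = ξ k := by
    intro k
    have : (ginv u x *ᵥ (hessian u x *ᵥ ξ)) k = ξ k := by
      rw [Matrix.mulVec_mulVec, ginv_mul_hessian hpos hx, Matrix.one_mulVec]
    exact this
  have hΓ2 : ∀ k, ∑ i, ∑ j, ginv u x i j * Christoffel u k i j x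
      = (1/2) * (ξ k - ∑ l, ginv u x k l * v l) := by
    intro k
    rw [htr]
    congr 1
    simp only [mul_add, Finset.sum_add_distrib, hgg, mul_neg, Finset.sum_neg_distrib]
    ring
  have hw : ∀ i, pd i (weight u ξ v) x = (1/2) * ((∑ q, hessian u x i q * ξ q) + v i) := by
    intro i
    have hxw : x + (0 : ℝ) • (Pi.single i 1 : Fin n → ℝ) ∈ N := by simpa using hx
    have hd : DifferentiableAt ℝ (weight u ξ v) x := by
      unfold weight
      refine DifferentiableAt.const_mul (DifferentiableAt.add ?_ ?_) _
      · refine DifferentiableAt.fun_sum fun p _ => ?_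
        exact (differentiableAt_of_contDiffOn hN (contDiffOn_pd hN hu p) hx).mul_const _
      · fun_prop
    have h2 : HasDerivAt (fun s : ℝ => x + s • (Pi.single i 1 : Fin n → ℝ)) (Pi.single i 1) 0 := by
      simpa using ((hasDerivAt_id (0 : ℝ)).smul_const (Pi.single i 1 : Fin n → ℝ)).const_add x
    have h3 : HasDerivAt (fun s : ℝ => weight u ξ v (x + s • (Pi.single i 1 : Fin n → ℝ)))
        (pd i (weight u ξ v) x) 0 := by
      have h0 : HasFDerivAt (weight u ξ v) (fderiv ℝ (weight u ξ v) x)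
        (x + (0 : ℝ) • (Pi.single i 1 : Fin n → ℝ)) := by simpa using hd.hasFDerivAt
      exact h0.comp_hasDerivAt 0 h2
    have h4 : HasDerivAt (fun s : ℝ => weight u ξ v (x + s • (Pi.single i 1 : Fin n → ℝ)))
        ((1/2) * ((∑ q, hessian u x i q * ξ q) + v i)) 0 := by
      unfold weight
      refine HasDerivAt.const_mul _ (HasDerivAt.add ?_ ?_)
      · refine HasDerivAt.fun_sum fun q _ => ?_
        have := hasDerivAt_line hN (contDiffOn_pd hN hu q) x (Pi.single i 1) hxw
        have h5 := this.mul_const (ξ q)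
        simpa [Pi.single_apply, hessian] using h5
      · have : HasDerivAt (fun s : ℝ => ∑ p, v p * (x + s • (Pi.single i 1 : Fin n → ℝ)) p)
            (∑ p, v p * (Pi.single i 1 : Fin n → ℝ) p) 0 := by
          refine HasDerivAt.fun_sum fun p _ => ?_
          have h := (((hasDerivAt_id (0 : ℝ)).mul_const
            ((Pi.single i 1 : Fin n → ℝ) p)).const_add (x p)).const_mul (v p)
          simpa using h
        simpa [Pi.single_apply] using this
    exact h3.unique h4
  have hlap : laplacian u F x = ∑ i, ∑ j, ginv u x i j * pd i (pd j F) x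
      - ∑ k, (∑ i, ∑ j, ginv u x i j * Christoffel u k i j x) * pd k F x := by
    simp only [laplacian, covHess, mul_sub, Finset.sum_sub_distrib, Finset.mul_sum, Finset.sum_mul]
    congr 1
    rw [Finset.sum_congr rfl fun i _ => Finset.sum_comm, Finset.sum_comm]
    refine Finset.sum_congr rfl fun l _ => Finset.sum_congr rfl fun i _ =>
      Finset.sum_congr rfl fun j _ => ?_
    ring
  have hdrift : ∑ i, ∑ j, ginv u x i j * pd i (weight u ξ v) x * pd j F x
      = ∑ k, (1/2) * (ξ k + ∑ l, ginv u x k l * v l) * pd k F x := by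
    rw [Finset.sum_comm]
    refine Finset.sum_congr rfl fun k _ => ?_
    rw [← Finset.sum_mul]
    congr 1
    rw [← hgg k, ← Finset.sum_add_distrib, Finset.mul_sum]
    refine Finset.sum_congr rfl fun i _ => ?_
    rw [hw, ginv_symm hpos hx i k]
    ring
  rw [driftLap, hlap, hdrift, sub_sub, ← Finset.sum_add_distrib]
  congr 1
  refine Finset.sum_congr rfl fun k _ => ?_
  rw [hΓ2]; ring

end MongeAmpere

/-- First and second order conditions for `F (B - E)²` at an interior maximum. -/
lemma second_order_test {F E F1 E1 : ℝ → ℝ} {F2 E2 B : ℝ}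
    (hF : ∀ᶠ t in 𝓝 (0 : ℝ), HasDerivAt F (F1 t) t) (hE : ∀ᶠ t in 𝓝 (0 : ℝ), HasDerivAt E (E1 t) t)
    (hF1 : HasDerivAt F1 F2 0) (hE1 : HasDerivAt E1 E2 0)
    (hB : 0 < B - E 0)
    (hmax : IsLocalMax (fun t => F t * (B - E t) ^ 2) 0) :
    F1 0 * (B - E 0) = 2 * F 0 * E1 0 ∧
      F2 * (B - E 0) ^ 2 ≤ 6 * F 0 * (E1 0) ^ 2 + 2 * F 0 * (B - E 0) * E2 := by
  set Φ := fun t => F t * (B - E t) ^ 2 with hΦ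
  set Φ1 := fun t => F1 t * (B - E t) ^ 2 - 2 * F t * (B - E t) * E1 t with hΦ1
  have hd : ∀ᶠ t in 𝓝 (0 : ℝ), HasDerivAt Φ (Φ1 t) t := by
    filter_upwards [hF, hE] with t h1 h2
    have := h1.mul ((h2.const_sub B).pow 2)
    refine this.congr_deriv ?_
    simp [hΦ1]; ring
  have hd2 : HasDerivAt Φ1 (F2 * (B - E 0) ^ 2 - 4 * F1 0 * (B - E 0) * E1 0
      + 2 * F 0 * (E1 0) ^ 2 - 2 * F 0 * (B - E 0) * E2) 0 := by
    have hF' := hF.self_of_nhds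
    have hE' := (hE.self_of_nhds).const_sub B
    have := (hF1.mul (hE'.pow 2)).sub (((hF'.const_mul 2).mul hE').mul hE1)
    refine this.congr_deriv ?_
    simp; ring
  have h0 : Φ1 0 = 0 := by
    have := hmax.deriv_eq_zero
    rwa [hd.self_of_nhds.deriv] at this
  have hfirst : F1 0 * (B - E 0) = 2 * F 0 * E1 0 := by
    have : (B - E 0) * (F1 0 * (B - E 0) - 2 * F 0 * E1 0) = 0 := by
      refine Eq.trans ?_ h0
      simp only [hΦ1]; ring
    rcases mul_eq_zero.1 this with h | h
    · exact absurd h hB.ne'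
    · linarith
  refine ⟨hfirst, ?_⟩
  have hdd : deriv Φ =ᶠ[𝓝 0] Φ1 := hd.mono fun t h => h.deriv
  have hdd2 : deriv (deriv Φ) 0 = F2 * (B - E 0) ^ 2 - 4 * F1 0 * (B - E 0) * E1 0
      + 2 * F 0 * (E1 0) ^ 2 - 2 * F 0 * (B - E 0) * E2 := by
    rw [hdd.deriv_eq, hd2.deriv]
  have hle : deriv (deriv Φ) 0 ≤ 0 := by
    by_contra hcon
    have hcon := not_le.1 hcon
    have hmin := isLocalMin_of_deriv_deriv_pos hcon hmax.deriv_eq_zero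
      hd.self_of_nhds.continuousAt
    have hconst : Φ =ᶠ[𝓝 0] fun _ => Φ 0 := by
      filter_upwards [hmax, hmin] with t h1 h2 using le_antisymm h1 h2
    have h2 : deriv Φ =ᶠ[𝓝 0] fun _ => 0 := by
      filter_upwards [hconst.eventuallyEq_nhds] with t ht
      rw [ht.deriv_eq]; simp
    rw [h2.deriv_eq] at hcon
    simp at hcon
  rw [hdd2] at hle
  have h3 : 4 * F1 0 * (B - E 0) * E1 0 = 8 * F 0 * (E1 0) ^ 2 := by
    have : 4 * F1 0 * (B - E 0) * E1 0 = 4 * (F1 0 * (B - E 0)) * E1 0 := by ring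
    rw [this, hfirst]; ring
  linarith

/-- The coordinate gradient of `u`. -/
def coordGrad (u : (Fin n → ℝ) → ℝ) (x : Fin n → ℝ) : Fin n → ℝ := fun p => pd p u x

/-- The symmetrized Bregman divergence of `u`, a discrete squared length of the step `a → b`. -/
def stepCost (u : (Fin n → ℝ) → ℝ) (a b : Fin n → ℝ) : ℝ :=
  (b - a) ⬝ᵥ (coordGrad u b - coordGrad u a)

/-- First variation of `stepCost`. -/
def stepVar (u : (Fin n → ℝ) → ℝ) (a b V W : Fin n → ℝ) : ℝ :=
  (W - V) ⬝ᵥ (coordGrad u b - coordGrad u a)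
    + (b - a) ⬝ᵥ (W ᵥ* hessian u b - V ᵥ* hessian u a)

/-- The contraction `V^i V^j u_{,ijp}`. -/
def cubic (u : (Fin n → ℝ) → ℝ) (x V : Fin n → ℝ) : Fin n → ℝ :=
  fun p => ∑ i, V i * ∑ j, V j * d3 u j i p x

/-- Second variation of `stepCost`. -/
def stepVar₂ (u : (Fin n → ℝ) → ℝ) (a b V W : Fin n → ℝ) : ℝ :=
  2 * ((W - V) ⬝ᵥ (W ᵥ* hessian u b - V ᵥ* hessian u a))
    + (b - a) ⬝ᵥ (cubic u b W - cubic u a V)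

/-- Discrete energy of the first `m` steps of the path `x`. -/
def energy (u : (Fin n → ℝ) → ℝ) (m : ℕ) (x : ℕ → Fin n → ℝ) : ℝ :=
  m * ∑ k ∈ Finset.range m, stepCost u (x k) (x (k + 1))

/-- First variation of `energy`. -/
def energyVar (u : (Fin n → ℝ) → ℝ) (m : ℕ) (x V : ℕ → Fin n → ℝ) : ℝ :=
  m * ∑ k ∈ Finset.range m, stepVar u (x k) (x (k + 1)) (V k) (V (k + 1))

/-- Second variation of `energy`. -/
def energyVar₂ (u : (Fin n → ℝ) → ℝ) (m : ℕ) (x V : ℕ → Fin n → ℝ) : ℝ :=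
  m * ∑ k ∈ Finset.range m, stepVar₂ u (x k) (x (k + 1)) (V k) (V (k + 1))

section Variation

variable {N : Set (Fin n → ℝ)} {u : (Fin n → ℝ) → ℝ}

lemma hasDerivAt_dotProduct {f g : ℝ → Fin n → ℝ} {f' g' : Fin n → ℝ} {t : ℝ}
    (hf : ∀ i, HasDerivAt (fun s => f s i) (f' i) t)
    (hg : ∀ i, HasDerivAt (fun s => g s i) (g' i) t) :
    HasDerivAt (fun s => f s ⬝ᵥ g s) (f' ⬝ᵥ g t + f t ⬝ᵥ g') t := by
  simp only [dotProduct, ← Finset.sum_add_distrib]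
  exact HasDerivAt.fun_sum fun i _ => (hf i).mul (hg i)

lemma hasDerivAt_sub_line (a b V W : Fin n → ℝ) (t : ℝ) (i : Fin n) :
    HasDerivAt (fun s : ℝ => (b + s • W - (a + s • V)) i) ((W - V) i) t := by
  have h1 := ((hasDerivAt_id t).mul_const (W i)).const_add (b i)
  have h2 := ((hasDerivAt_id t).mul_const (V i)).const_add (a i)
  simpa using h1.fun_sub h2

lemma hasDerivAt_stepCost (hN : IsOpen N) (hu : ContDiffOn ℝ (⊤ : ℕ∞) u N) (a b V W : Fin n → ℝ)
    {t : ℝ} (ha : a + t • V ∈ N) (hb : b + t • W ∈ N) :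
    HasDerivAt (fun s : ℝ => stepCost u (a + s • V) (b + s • W))
      (stepVar u (a + t • V) (b + t • W) V W) t := by
  refine hasDerivAt_dotProduct (fun i => hasDerivAt_sub_line a b V W t i) fun p => ?_
  exact (hasDerivAt_line hN (contDiffOn_pd hN hu p) b W hb).sub
    (hasDerivAt_line hN (contDiffOn_pd hN hu p) a V ha)

lemma hasDerivAt_stepVar (hN : IsOpen N) (hu : ContDiffOn ℝ (⊤ : ℕ∞) u N) (a b V W : Fin n → ℝ)
    {t : ℝ} (ha : a + t • V ∈ N) (hb : b + t • W ∈ N) :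
    HasDerivAt (fun s : ℝ => stepVar u (a + s • V) (b + s • W) V W)
      (stepVar₂ u (a + t • V) (b + t • W) V W) t := by
  have hh : ∀ (a V : Fin n → ℝ), a + t • V ∈ N → ∀ p,
      HasDerivAt (fun s : ℝ => (V ᵥ* hessian u (a + s • V)) p) (cubic u (a + t • V) V p) t := by
    intro a V ha p
    change HasDerivAt (fun s : ℝ => ∑ i, V i * pd i (pd p u) (a + s • V))
      (∑ i, V i * ∑ j, V j * d3 u j i p (a + t • V)) t
    refine HasDerivAt.fun_sum fun i _ => HasDerivAt.const_mul _ ?_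
    exact hasDerivAt_line hN (contDiffOn_pd hN (contDiffOn_pd hN hu p) i) a V ha
  have h1 := hasDerivAt_dotProduct (f := fun _ => W - V) (f' := 0)
    (g := fun s : ℝ => coordGrad u (b + s • W) - coordGrad u (a + s • V))
    (g' := W ᵥ* hessian u (b + t • W) - V ᵥ* hessian u (a + t • V)) (t := t)
    (fun i => hasDerivAt_const t _) fun p =>
      (hasDerivAt_line hN (contDiffOn_pd hN hu p) b W hb).sub
        (hasDerivAt_line hN (contDiffOn_pd hN hu p) a V ha)
  have h2 := hasDerivAt_dotProduct (fun i => hasDerivAt_sub_line a b V W t i)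
    (g := fun s : ℝ => W ᵥ* hessian u (b + s • W) - V ᵥ* hessian u (a + s • V))
    (g' := cubic u (b + t • W) W - cubic u (a + t • V) V)
    fun p => (hh b W hb p).sub (hh a V ha p)
  refine (h1.add h2).congr_deriv ?_
  simp only [stepVar₂, zero_dotProduct]
  ring

lemma hasDerivAt_energy (hN : IsOpen N) (hu : ContDiffOn ℝ (⊤ : ℕ∞) u N) {m : ℕ}
    (x V : ℕ → Fin n → ℝ) {t : ℝ} (hx : ∀ k ≤ m, x k + t • V k ∈ N) :
    HasDerivAt (fun s : ℝ => energy u m (x + s • V)) (energyVar u m (x + t • V) V) t := by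
  refine HasDerivAt.const_mul _ (HasDerivAt.fun_sum fun k hk => ?_)
  have := Finset.mem_range.1 hk
  exact hasDerivAt_stepCost hN hu _ _ _ _ (hx k (by omega)) (hx (k + 1) (by omega))

lemma hasDerivAt_energyVar (hN : IsOpen N) (hu : ContDiffOn ℝ (⊤ : ℕ∞) u N) {m : ℕ}
    (x V : ℕ → Fin n → ℝ) {t : ℝ} (hx : ∀ k ≤ m, x k + t • V k ∈ N) :
    HasDerivAt (fun s : ℝ => energyVar u m (x + s • V) V) (energyVar₂ u m (x + t • V) V) t := by
  refine HasDerivAt.const_mul _ (HasDerivAt.fun_sum fun k hk => ?_)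
  have := Finset.mem_range.1 hk
  exact hasDerivAt_stepVar hN hu _ _ _ _ (hx k (by omega)) (hx (k + 1) (by omega))

lemma eventually_line_mem (hN : IsOpen N) {m : ℕ} {x : ℕ → Fin n → ℝ} (V : ℕ → Fin n → ℝ)
    (hx : ∀ k ≤ m, x k ∈ N) : ∀ᶠ t in 𝓝 (0 : ℝ), ∀ k ≤ m, x k + t • V k ∈ N := by
  have : ∀ᶠ t in 𝓝 (0 : ℝ), ∀ k ∈ Finset.range (m + 1), x k + t • V k ∈ N := by
    rw [Filter.eventually_all_finset]
    intro k hk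
    have hc : ContinuousAt (fun t : ℝ => x k + t • V k) 0 := by fun_prop
    refine hc.preimage_mem_nhds (hN.mem_nhds ?_)
    simpa using hx k (Nat.lt_succ_iff.1 (Finset.mem_range.1 hk))
  filter_upwards [this] with t ht k hk using ht k (Finset.mem_range.2 (Nat.lt_succ_iff.2 hk))

/-- First and second variation conditions at a path maximizing `F (B - energy)²`. -/
lemma variation_conditions (hN : IsOpen N) (hu : ContDiffOn ℝ (⊤ : ℕ∞) u N)
    {F : (Fin n → ℝ) → ℝ} (hF : ContDiffOn ℝ (⊤ : ℕ∞) F N) {m : ℕ} {x : ℕ → Fin n → ℝ} {B : ℝ}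
    (V : ℕ → Fin n → ℝ) (hx : ∀ k ≤ m, x k ∈ N) (hB : 0 < B - energy u m x)
    (hmax : ∀ᶠ t in 𝓝 (0 : ℝ), F (x m + t • V m) * (B - energy u m (x + t • V)) ^ 2
      ≤ F (x m) * (B - energy u m x) ^ 2) :
    (∑ i, V m i * pd i F (x m)) * (B - energy u m x) = 2 * F (x m) * energyVar u m x V ∧
      (∑ i, V m i * ∑ j, V m j * pd j (pd i F) (x m)) * (B - energy u m x) ^ 2
        ≤ 6 * F (x m) * (energyVar u m x V) ^ 2
          + 2 * F (x m) * (B - energy u m x) * energyVar₂ u m x V := by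
  have hev := eventually_line_mem hN V hx
  have h0 : ∀ k ≤ m, x k + (0 : ℝ) • V k ∈ N := by simpa using hx
  have key := second_order_test (F := fun t : ℝ => F (x m + t • V m))
    (E := fun t : ℝ => energy u m (x + t • V))
    (F1 := fun t : ℝ => ∑ i, V m i * pd i F (x m + t • V m))
    (E1 := fun t : ℝ => energyVar u m (x + t • V) V)
    (F2 := ∑ i, V m i * ∑ j, V m j * pd j (pd i F) (x m))
    (E2 := energyVar₂ u m x V) (B := B)
    (hev.mono fun t ht => hasDerivAt_line hN hF _ _ (ht m le_rfl))
    (hev.mono fun t ht => hasDerivAt_energy hN hu x V ht)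
    (by
      refine HasDerivAt.fun_sum fun i _ => HasDerivAt.const_mul _ ?_
      simpa using hasDerivAt_line hN (contDiffOn_pd hN hF i) (x m) (V m) (h0 m le_rfl))
    (by simpa using hasDerivAt_energyVar hN hu x V h0)
    (by simpa using hB)
    (by simpa [IsLocalMax, IsMaxFilter] using hmax)
  simpa using key

end Variation

section Frames

open scoped MatrixOrder in
lemma exists_posDef_sq_eq {A : Matrix (Fin n) (Fin n) ℝ} (hA : A.PosDef) :
    ∃ S : Matrix (Fin n) (Fin n) ℝ, S.PosDef ∧ S * S = A := by
  have hS : CFC.sqrt A * CFC.sqrt A = A := CFC.sqrt_mul_sqrt_self A hA.posSemidef.nonneg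
  refine ⟨CFC.sqrt A, ?_, hS⟩
  have h1 : (CFC.sqrt A).PosSemidef := (CFC.sqrt_nonneg A).posSemidef
  refine h1.posDef_iff_isUnit.2 ?_
  rw [Matrix.isUnit_iff_isUnit_det]
  have h2 : (CFC.sqrt A).det * (CFC.sqrt A).det = A.det := by rw [← Matrix.det_mul, hS]
  refine isUnit_iff_ne_zero.2 fun h0 => hA.det_pos.ne' ?_
  rw [← h2, h0, zero_mul]

lemma two_mul_le_trace_add_trace_inv {S : Matrix (Fin n) (Fin n) ℝ} (hS : S.PosDef) :
    2 * (n : ℝ) ≤ S⁻¹.trace + S.trace := by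
  have hdet : IsUnit S.det := hS.det_pos.ne'.isUnit
  have h := (hS.inv.posSemidef.conjTranspose_mul_mul_same (S - 1)).trace_nonneg
  have hs : (S - 1)ᴴ = S - 1 := by
    rw [Matrix.conjTranspose_sub, hS.isHermitian.eq, Matrix.conjTranspose_one]
  have e : (S - 1)ᴴ * S⁻¹ * (S - 1) = S + S⁻¹ - 2 • (1 : Matrix (Fin n) (Fin n) ℝ) := by
    rw [hs, sub_mul, Matrix.mul_nonsing_inv _ hdet, one_mul, mul_sub, sub_mul, mul_one,
      one_mul, Matrix.nonsing_inv_mul _ hdet, two_smul]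
    abel
  rw [e, Matrix.trace_sub, Matrix.trace_add, Matrix.trace_smul, Matrix.trace_one] at h
  simp at h
  linarith

/-- Discrete parallel transport: a `G`-orthonormal frame can be moved to an `H`-orthonormal frame
without decreasing the symmetrized pairing. -/
lemma exists_transported_frame {P G H : Matrix (Fin n) (Fin n) ℝ} (hG : G.PosDef) (hH : H.PosDef)
    (hP : P * Pᵀ = G⁻¹) :
    ∃ P' : Matrix (Fin n) (Fin n) ℝ, P' * P'ᵀ = H⁻¹ ∧
      2 * (n : ℝ) ≤ (Pᵀ * H * P').trace + (P'ᵀ * G * P).trace := by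
  have hGu : IsUnit G.det := hG.det_pos.ne'.isUnit
  have hHu : IsUnit H.det := hH.det_pos.ne'.isUnit
  have hPu : IsUnit P.det := by
    refine isUnit_iff_ne_zero.2 fun h0 => ?_
    have h1 : P.det * Pᵀ.det = G⁻¹.det := by rw [← Matrix.det_mul, hP]
    rw [h0, zero_mul] at h1
    exact hG.inv.det_pos.ne h1
  have hPtu : IsUnit Pᵀ.det := by rwa [Matrix.det_transpose]
  have hA : (Pᵀ * H * P).PosDef := by
    have := hH.conjTranspose_mul_mul_same (B := P) (by
      exact Matrix.mulVec_injective_of_isUnit ((Matrix.isUnit_iff_isUnit_det P).2 hPu))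
    simpa [Matrix.conjTranspose_eq_transpose_of_trivial] using this
  set A := Pᵀ * H * P with hAdef
  obtain ⟨S, hS, hSS⟩ := exists_posDef_sq_eq hA.inv
  have hSu : IsUnit S.det := hS.det_pos.ne'.isUnit
  have hAu : IsUnit A.det := hA.det_pos.ne'.isUnit
  have hSt : Sᵀ = S := by
    have := hS.isHermitian.eq
    rwa [Matrix.conjTranspose_eq_transpose_of_trivial] at this
  have hAinv : A⁻¹ = P⁻¹ * (H⁻¹ * Pᵀ⁻¹) := by
    rw [hAdef, Matrix.mul_inv_rev, Matrix.mul_inv_rev]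
  have hPGP : Pᵀ * G * P = 1 := by
    have h1 : G = (P * Pᵀ)⁻¹ := by rw [hP, Matrix.nonsing_inv_nonsing_inv _ hGu]
    rw [h1, Matrix.mul_inv_rev, ← Matrix.mul_assoc, Matrix.mul_nonsing_inv _ hPtu, one_mul,
      Matrix.nonsing_inv_mul _ hPu]
  refine ⟨P * S, ?_, ?_⟩
  · rw [Matrix.transpose_mul, hSt]
    calc P * S * (S * Pᵀ) = P * (S * S) * Pᵀ := by simp only [Matrix.mul_assoc]
      _ = (P * P⁻¹) * H⁻¹ * (Pᵀ⁻¹ * Pᵀ) := by rw [hSS, hAinv]; simp only [Matrix.mul_assoc]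
      _ = H⁻¹ := by
        rw [Matrix.mul_nonsing_inv _ hPu, Matrix.nonsing_inv_mul _ hPtu, one_mul, mul_one]
  · have h1 : Pᵀ * H * (P * S) = S⁻¹ := by
      rw [← Matrix.mul_assoc, ← hAdef]
      have : A = S⁻¹ * S⁻¹ := by
        rw [← Matrix.mul_inv_rev, hSS, Matrix.nonsing_inv_nonsing_inv _ hAu]
      rw [this, Matrix.mul_assoc, Matrix.nonsing_inv_mul _ hSu, mul_one]
    have h2 : (P * S)ᵀ * G * P = S := by
      rw [Matrix.transpose_mul, hSt, Matrix.mul_assoc, Matrix.mul_assoc, ← Matrix.mul_assoc Pᵀ,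
        hPGP, mul_one]
    rw [h1, h2]
    exact two_mul_le_trace_add_trace_inv hS

/-- A discretely parallel family of orthonormal frames along a sequence of inner products. -/
lemma exists_parallel_frames (G : ℕ → Matrix (Fin n) (Fin n) ℝ) (hG : ∀ k, (G k).PosDef) :
    ∃ P : ℕ → Matrix (Fin n) (Fin n) ℝ, (∀ k, P k * (P k)ᵀ = (G k)⁻¹) ∧
      ∀ k, 2 * (n : ℝ) ≤ ((P k)ᵀ * G (k + 1) * P (k + 1)).trace
        + ((P (k + 1))ᵀ * G k * P k).trace := by
  obtain ⟨P₀, hP₀, -⟩ := exists_transported_frame (P := 1) (G := 1) Matrix.PosDef.one (hG 0)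
    (by simp)
  let next : ∀ k, {P : Matrix (Fin n) (Fin n) ℝ // P * Pᵀ = (G k)⁻¹} →
      {P : Matrix (Fin n) (Fin n) ℝ // P * Pᵀ = (G (k + 1))⁻¹} := fun k P =>
    ⟨(exists_transported_frame (hG k) (hG (k + 1)) P.2).choose,
      (exists_transported_frame (hG k) (hG (k + 1)) P.2).choose_spec.1⟩
  let Q : ∀ k, {P : Matrix (Fin n) (Fin n) ℝ // P * Pᵀ = (G k)⁻¹} := fun k =>
    Nat.rec ⟨P₀, hP₀⟩ next k
  exact ⟨fun k => (Q k).1, fun k => (Q k).2, fun k =>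
    (exists_transported_frame (hG k) (hG (k + 1)) (Q k).2).choose_spec.2⟩

end Frames

section FrameSums

variable {N : Set (Fin n → ℝ)} {u : (Fin n → ℝ) → ℝ} {v ξ : Fin n → ℝ} {c : ℝ}

lemma sum_frame_bilin (P : Matrix (Fin n) (Fin n) ℝ) (C : Fin n → Fin n → ℝ) :
    ∑ a, ∑ i, Pᵀ a i * ∑ j, Pᵀ a j * C i j = ∑ i, ∑ j, (P * Pᵀ) i j * C i j := by
  simp only [Matrix.mul_apply, Finset.mul_sum, Finset.sum_mul]
  rw [Finset.sum_comm]
  refine Finset.sum_congr rfl fun i _ => ?_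
  rw [Finset.sum_comm]
  refine Finset.sum_congr rfl fun j _ => Finset.sum_congr rfl fun a _ => ?_
  simp only [Matrix.transpose_apply]
  ring

lemma sum_frame_dotProduct_vecMul (P Q G : Matrix (Fin n) (Fin n) ℝ) :
    ∑ a, Pᵀ a ⬝ᵥ (Qᵀ a ᵥ* G) = (Qᵀ * G * P).trace := by
  simp only [Matrix.trace, Matrix.diag, Matrix.mul_apply, dotProduct, Matrix.vecMul]
  refine Finset.sum_congr rfl fun a _ => Finset.sum_congr rfl fun p _ => ?_
  rw [mul_comm, Matrix.transpose_apply P]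

lemma sum_frame_dotProduct_sq (P : Matrix (Fin n) (Fin n) ℝ) (w : Fin n → ℝ) :
    ∑ a, (Pᵀ a ⬝ᵥ w) ^ 2 = w ⬝ᵥ ((P * Pᵀ) *ᵥ w) := by
  have := sum_frame_bilin P fun i j => w i * w j
  calc ∑ a, (Pᵀ a ⬝ᵥ w) ^ 2 = ∑ a, ∑ i, Pᵀ a i * ∑ j, Pᵀ a j * (w i * w j) := by
        refine Finset.sum_congr rfl fun a _ => ?_
        rw [sq, dotProduct, Finset.sum_mul]
        refine Finset.sum_congr rfl fun i _ => ?_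
        rw [mul_assoc, Finset.mul_sum]
        congr 1
        exact Finset.sum_congr rfl fun j _ => by ring
    _ = _ := by
        rw [this]
        simp only [dotProduct, Matrix.mulVec, Finset.mul_sum]
        exact Finset.sum_congr rfl fun i _ => Finset.sum_congr rfl fun j _ => by ring

lemma trace_frame_eq {P G : Matrix (Fin n) (Fin n) ℝ} (hG : G.PosDef) (hP : P * Pᵀ = G⁻¹) :
    (Pᵀ * G * P).trace = n := by
  rw [Matrix.mul_assoc, Matrix.trace_mul_comm, Matrix.mul_assoc, hP,
    Matrix.mul_nonsing_inv _ hG.det_pos.ne'.isUnit, Matrix.trace_one, Fintype.card_fin]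

/-- Tracing the cubic form over an orthonormal frame, by the differentiated Monge–Ampère
equation. -/
lemma sum_cubic_frame (hN : IsOpen N) (hu : ContDiffOn ℝ (⊤ : ℕ∞) u N)
    (hpos : ∀ x ∈ N, (hessian u x).PosDef) (hMA : MAeq u N v ξ c) {x : Fin n → ℝ} (hx : x ∈ N)
    {P : Matrix (Fin n) (Fin n) ℝ} (hP : P * Pᵀ = (hessian u x)⁻¹) (s : ℝ) :
    ∑ a, cubic u x (s • Pᵀ a) = s ^ 2 • (-v + ξ ᵥ* hessian u x) := by
  ext p
  rw [Finset.sum_apply]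
  have h1 : ∀ a, cubic u x (s • Pᵀ a) p
      = s ^ 2 * ∑ i, Pᵀ a i * ∑ j, Pᵀ a j * d3 u p i j x := by
    intro a
    simp only [cubic, Finset.mul_sum, Pi.smul_apply, smul_eq_mul]
    refine Finset.sum_congr rfl fun i _ => Finset.sum_congr rfl fun j _ => ?_
    rw [d3_swap_right hN hu hx j i p, d3_swap_left hN hu hx j p i, d3_swap_right hN hu hx p j i]
    ring
  simp only [h1]
  rw [← Finset.mul_sum, sum_frame_bilin, hP]
  have := sum_ginv_mul_d3 hN hu hpos hMA hx p
  rw [ginv] at this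
  rw [this]
  simp only [Pi.smul_apply, Pi.add_apply, Pi.neg_apply, smul_eq_mul, Matrix.vecMul, dotProduct]
  congr 2
  exact Finset.sum_congr rfl fun q _ => by rw [hessian_symm hN hu hx p q]; ring

/-- The trace of the second variation of a step over parallel frames is controlled by the first
variation in the direction of the drift field. -/
lemma sum_stepVar₂_frame_le (hN : IsOpen N) (hu : ContDiffOn ℝ (⊤ : ℕ∞) u N)
    (hpos : ∀ x ∈ N, (hessian u x).PosDef) (hMA : MAeq u N v ξ c) {a b : Fin n → ℝ}
    (ha : a ∈ N) (hb : b ∈ N) {P Q : Matrix (Fin n) (Fin n) ℝ} (hP : P * Pᵀ = (hessian u a)⁻¹)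
    (hQ : Q * Qᵀ = (hessian u b)⁻¹)
    (hPQ : 2 * (n : ℝ) ≤ (Pᵀ * hessian u b * Q).trace + (Qᵀ * hessian u a * P).trace)
    {s t : ℝ} (hs : 0 ≤ s) (ht : 0 ≤ t) :
    ∑ e, stepVar₂ u a b (s • Pᵀ e) (t • Qᵀ e)
      ≤ stepVar u a b (s ^ 2 • ξ) (t ^ 2 • ξ) + 2 * n * (t - s) ^ 2
        - (t ^ 2 - s ^ 2) * (v ⬝ᵥ (b - a) + ξ ⬝ᵥ (coordGrad u b - coordGrad u a)) := by
  set A := hessian u a with hA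
  set B := hessian u b with hB
  have quad : ∑ e, (t • Qᵀ e - s • Pᵀ e) ⬝ᵥ ((t • Qᵀ e) ᵥ* B - (s • Pᵀ e) ᵥ* A)
      = t ^ 2 * n + s ^ 2 * n - s * t * ((Pᵀ * B * Q).trace + (Qᵀ * A * P).trace) := by
    have hBt : Bᵀ = B := by ext i j; exact hessian_symm hN hu hb j i
    have hsym : (Qᵀ * B * P).trace = (Pᵀ * B * Q).trace := by
      rw [← Matrix.trace_transpose, Matrix.transpose_mul, Matrix.transpose_mul, hBt,
        Matrix.transpose_transpose, Matrix.mul_assoc]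
    have hAt : Aᵀ = A := by ext i j; exact hessian_symm hN hu ha j i
    have hsym' : (Pᵀ * A * Q).trace = (Qᵀ * A * P).trace := by
      rw [← Matrix.trace_transpose, Matrix.transpose_mul, Matrix.transpose_mul, hAt,
        Matrix.transpose_transpose, Matrix.mul_assoc]
    calc _ = ∑ e, (t ^ 2 * (Qᵀ e ⬝ᵥ (Qᵀ e ᵥ* B)) + s ^ 2 * (Pᵀ e ⬝ᵥ (Pᵀ e ᵥ* A))
          - s * t * (Pᵀ e ⬝ᵥ (Qᵀ e ᵥ* B) + Qᵀ e ⬝ᵥ (Pᵀ e ᵥ* A))) := by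
          refine Finset.sum_congr rfl fun e _ => ?_
          simp only [Matrix.smul_vecMul, sub_dotProduct, dotProduct_sub, smul_dotProduct,
            dotProduct_smul, smul_eq_mul]
          ring
      _ = _ := by
          rw [Finset.sum_sub_distrib, Finset.sum_add_distrib, ← Finset.mul_sum, ← Finset.mul_sum,
            ← Finset.mul_sum, Finset.sum_add_distrib]
          simp only [sum_frame_dotProduct_vecMul]
          rw [trace_frame_eq (hpos a ha) hP, trace_frame_eq (hpos b hb) hQ, hsym, hsym']
  have hcub : ∑ e, (b - a) ⬝ᵥ (cubic u b (t • Qᵀ e) - cubic u a (s • Pᵀ e))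
      = (b - a) ⬝ᵥ (t ^ 2 • (-v + ξ ᵥ* B) - s ^ 2 • (-v + ξ ᵥ* A)) := by
    rw [← dotProduct_sum, Finset.sum_sub_distrib, sum_cubic_frame hN hu hpos hMA hb hQ,
      sum_cubic_frame hN hu hpos hMA ha hP]
  simp only [stepVar₂]
  rw [Finset.sum_add_distrib, ← Finset.mul_sum, hcub, quad]
  have hst := mul_le_mul_of_nonneg_left hPQ (mul_nonneg hs ht)
  simp only [stepVar, Matrix.smul_vecMul, sub_dotProduct, dotProduct_sub, smul_dotProduct,
    dotProduct_smul, smul_eq_mul, dotProduct_add, dotProduct_neg]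
  rw [dotProduct_comm a v, dotProduct_comm b v]
  nlinarith [hst]

end FrameSums

section Maximizers

variable {N : Set (Fin n → ℝ)} {u F : (Fin n → ℝ) → ℝ} {v ξ : Fin n → ℝ} {c : ℝ}

/-- The path `x` locally maximizes `F (B - energy)²` among variations fixing its initial point. -/
def IsPathMax (u F : (Fin n → ℝ) → ℝ) (m : ℕ) (B : ℝ) (x : ℕ → Fin n → ℝ) : Prop :=
  ∀ V : ℕ → Fin n → ℝ, V 0 = 0 → ∀ᶠ t in 𝓝 (0 : ℝ),
    F (x m + t • V m) * (B - energy u m (x + t • V)) ^ 2 ≤ F (x m) * (B - energy u m x) ^ 2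

variable {m : ℕ} {B : ℝ} {x : ℕ → Fin n → ℝ}

lemma energyVar_single {k : ℕ} (hk : k + 1 < m)
    (w : Fin n → ℝ) :
    energyVar u m x (Pi.single (k + 1) w) =
      m * (stepVar u (x k) (x (k + 1)) 0 w + stepVar u (x (k + 1)) (x (k + 2)) w 0) := by
  rw [energyVar]
  congr 1
  rw [Finset.sum_eq_add_of_mem k (k + 1) (by simp; omega) (by simp; omega) (by omega)]
  · rw [Pi.single_eq_same, Pi.single_eq_of_ne (by omega), Pi.single_eq_of_ne (by omega)]
  · intro j _ hj
    rw [Pi.single_eq_of_ne (by omega), Pi.single_eq_of_ne (by omega)]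
    simp [stepVar]

lemma energyVar_single_last (hm : 0 < m) (w : Fin n → ℝ) :
    energyVar u m x (Pi.single m w) = m * stepVar u (x (m - 1)) (x m) 0 w := by
  rw [energyVar]
  congr 1
  rw [Finset.sum_eq_single_of_mem (m - 1) (by simp; omega)]
  · rw [Nat.sub_add_cancel hm, Pi.single_eq_same, Pi.single_eq_of_ne (by omega)]
  · intro j hj hj'
    have := Finset.mem_range.1 hj
    rw [Pi.single_eq_of_ne (by omega), Pi.single_eq_of_ne (by omega)]
    simp [stepVar]

lemma stepVar_zero_left (a b w : Fin n → ℝ) :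
    stepVar u a b 0 w = w ⬝ᵥ (coordGrad u b - coordGrad u a + hessian u b *ᵥ (b - a)) := by
  rw [stepVar, zero_vecMul, sub_zero, sub_zero, dotProduct_add, dotProduct_mulVec,
    dotProduct_comm (b - a)]

lemma stepVar_zero_right (a b w : Fin n → ℝ) :
    stepVar u a b w 0 = -(w ⬝ᵥ (coordGrad u b - coordGrad u a + hessian u a *ᵥ (b - a))) := by
  rw [stepVar, zero_vecMul, zero_sub, zero_sub, dotProduct_add, dotProduct_mulVec,
    dotProduct_comm (b - a), neg_dotProduct, neg_dotProduct, neg_add]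

/-- The discrete geodesic equation at an interior vertex of a maximizing path. -/
lemma IsPathMax.interior (hN : IsOpen N) (hu : ContDiffOn ℝ (⊤ : ℕ∞) u N)
    (hF : ContDiffOn ℝ (⊤ : ℕ∞) F N) (hmax : IsPathMax u F m B x) (hx : ∀ k ≤ m, x k ∈ N)
    (hB : 0 < B - energy u m x) (hFm : 0 < F (x m)) {k : ℕ} (hk : k + 1 < m) :
    coordGrad u (x (k + 1)) - coordGrad u (x k) + hessian u (x (k + 1)) *ᵥ (x (k + 1) - x k)
      = coordGrad u (x (k + 2)) - coordGrad u (x (k + 1))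
        + hessian u (x (k + 1)) *ᵥ (x (k + 2) - x (k + 1)) := by
  refine dotProduct_eq _ _ fun w => ?_
  have h := (variation_conditions hN hu hF (Pi.single (k + 1) w) hx hB
    (hmax _ (Pi.single_eq_of_ne (by omega) _))).1
  rw [Pi.single_eq_of_ne (by omega), energyVar_single hk,
    stepVar_zero_left, stepVar_zero_right] at h
  simp only [Pi.zero_apply, zero_mul, Finset.sum_const_zero] at h
  have hm : (m : ℝ) ≠ 0 := by
    have : 0 < m := by omega
    positivity
  have h2 := mul_eq_zero.1 h.symm
  rcases h2 with h2 | h2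
  · linarith
  · rcases mul_eq_zero.1 h2 with h2 | h2
    · exact absurd h2 hm
    · rw [dotProduct_comm _ w, dotProduct_comm _ w]
      linarith

/-- The discrete Cheng–Yau inequality at a maximizing path, for an arbitrary cut-off `f`. -/
lemma IsPathMax.main_inequality (hN : IsOpen N) (hu : ContDiffOn ℝ (⊤ : ℕ∞) u N)
    (hpos : ∀ x ∈ N, (hessian u x).PosDef) (hMA : MAeq u N v ξ c)
    (hF : ContDiffOn ℝ (⊤ : ℕ∞) F N)
    (hineq : ∀ x ∈ N, driftLap u (weight u ξ v) F x ≥ (F x) ^ 2)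
    (hmax : IsPathMax u F m B x) (hx : ∀ k, x k ∈ N) (hm : 0 < m)
    (hB : 0 < B - energy u m x) (hFm : 0 < F (x m))
    {f : ℕ → ℝ} (hf : ∀ k, 0 ≤ f k) (hf0 : f 0 = 0) (hfm : f m = 1)
    {η : Fin n → ℝ} (hη : η = coordGrad u (x m) - coordGrad u (x (m - 1))
      + hessian u (x m) *ᵥ (x m - x (m - 1))) :
    F (x m) * (B - energy u m x) ^ 2 ≤ 6 * (m ^ 2 * (η ⬝ᵥ (ginv u (x m) *ᵥ η)))
      + 2 * (B - energy u m x) * (m * ∑ k ∈ Finset.range m, (2 * n * (f (k + 1) - f k) ^ 2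
        - (f (k + 1) ^ 2 - f k ^ 2) * (v ⬝ᵥ (x (k + 1) - x k)
          + ξ ⬝ᵥ (coordGrad u (x (k + 1)) - coordGrad u (x k))))) := by
  obtain ⟨P, hP, hPP⟩ := exists_parallel_frames (fun k => hessian u (x k)) fun k => hpos _ (hx k)
  set H := B - energy u m x with hH
  have hx' : ∀ k ≤ m, x k ∈ N := fun k _ => hx k
  set V : Fin n → ℕ → Fin n → ℝ := fun e k => f k • (P k)ᵀ e with hV
  set Z : ℕ → Fin n → ℝ := fun k => f k ^ 2 • ξ with hZ
  have hVm : ∀ e, V e m = (P m)ᵀ e := fun e => by simp [hV, hfm]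
  have hZm : Z m = ξ := by simp [hZ, hfm]
  have cV := fun e => variation_conditions hN hu hF (V e) hx' hB (hmax _ (by simp [hV, hf0]))
  have cW := fun e => variation_conditions hN hu hF (Pi.single m ((P m)ᵀ e)) hx' hB
    (hmax _ (Pi.single_eq_of_ne (by omega) _))
  have cZ := variation_conditions hN hu hF Z hx' hB (hmax _ (by simp [hZ, hf0]))
  have hE1 : ∀ e, energyVar u m x (V e) = m * ((P m)ᵀ e ⬝ᵥ η) := by
    intro e
    have h1 := (cV e).1
    have h2 := (cW e).1
    rw [Pi.single_eq_same, energyVar_single_last hm,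
      stepVar_zero_left, ← hη] at h2
    rw [hVm, h2] at h1
    exact (mul_left_cancel₀ (by positivity) h1).symm
  have hsq : ∑ e, energyVar u m x (V e) ^ 2 = m ^ 2 * (η ⬝ᵥ (ginv u (x m) *ᵥ η)) := by
    simp only [hE1, mul_pow]
    rw [← Finset.mul_sum, sum_frame_dotProduct_sq, hP, ginv]
  set T := (m : ℝ) * ∑ k ∈ Finset.range m, (2 * n * (f (k + 1) - f k) ^ 2
        - (f (k + 1) ^ 2 - f k ^ 2) * (v ⬝ᵥ (x (k + 1) - x k)
          + ξ ⬝ᵥ (coordGrad u (x (k + 1)) - coordGrad u (x k)))) with hT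
  have hE2 : ∑ e, energyVar₂ u m x (V e) ≤ energyVar u m x Z + T := by
    simp only [energyVar₂, energyVar, hT]
    rw [← Finset.mul_sum, ← mul_add, Finset.sum_comm, ← Finset.sum_add_distrib]
    refine mul_le_mul_of_nonneg_left (Finset.sum_le_sum fun k _ => ?_) (by positivity)
    have := sum_stepVar₂_frame_le hN hu hpos hMA (hx k) (hx (k + 1)) (hP k) (hP (k + 1)) (hPP k)
      (hf k) (hf (k + 1))
    simp only [hV, hZ]
    linarith
  have hsum : (∑ i, ∑ j, ginv u (x m) i j * pd i (pd j F) (x m)) * H ^ 2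
      ≤ 6 * F (x m) * (∑ e, energyVar u m x (V e) ^ 2)
        + 2 * F (x m) * H * ∑ e, energyVar₂ u m x (V e) := by
    have h1 := Finset.sum_le_sum fun e (_ : e ∈ Finset.univ) => (cV e).2
    rw [Finset.sum_add_distrib, ← Finset.mul_sum, ← Finset.mul_sum, ← Finset.sum_mul] at h1
    simp only [hVm] at h1
    rw [sum_frame_bilin, hP] at h1
    refine le_trans (le_of_eq ?_) h1
    rw [ginv]
    congr 1
    exact Finset.sum_congr rfl fun i _ => Finset.sum_congr rfl fun j _ => by
      rw [pd_comm hN hF (hx m) i j]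
  have hdrift := hineq _ (hx m)
  rw [driftLap_weight_eq hN hu hpos hMA (hx m)] at hdrift
  have h1 := cZ.1
  rw [hZm] at h1
  have h2 := mul_le_mul_of_nonneg_right hdrift (sq_nonneg H)
  have h3 : (∑ k, ξ k * pd k F (x m)) * H ^ 2 = 2 * F (x m) * H * energyVar u m x Z := by
    rw [sq, ← mul_assoc, h1]; ring
  have h4 := mul_le_mul_of_nonneg_left hE2 (show 0 ≤ 2 * F (x m) * H by positivity)
  rw [← hsq]
  refine le_of_mul_le_mul_left ?_ hFm
  nlinarith

end Maximizers

section Reachability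

/-- The quadratic form of the Hessian metric. -/
def quad (u : (Fin n → ℝ) → ℝ) (z w : Fin n → ℝ) : ℝ := w ⬝ᵥ (hessian u z *ᵥ w)

lemma quad_smul (u : (Fin n → ℝ) → ℝ) (z w : Fin n → ℝ) (t : ℝ) :
    quad u z (t • w) = t ^ 2 * quad u z w := by
  simp only [quad, mulVec_smul, dotProduct_smul, smul_dotProduct, smul_eq_mul]
  ring

lemma quad_eq_sum (u : (Fin n → ℝ) → ℝ) (z w : Fin n → ℝ) :
    quad u z w = ∑ i, ∑ j, hessian u z i j * w i * w j := by
  simp only [quad, dotProduct, mulVec, Finset.mul_sum]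
  exact Finset.sum_congr rfl fun i _ => Finset.sum_congr rfl fun j _ => by ring

/-- The segment from `a` to `b` lies in `N` and its constant speed is at most `ℓ`. -/
def IsStep (u : (Fin n → ℝ) → ℝ) (N : Set (Fin n → ℝ)) (a b : Fin n → ℝ) (ℓ : ℝ) : Prop :=
  0 ≤ ℓ ∧ ∀ z ∈ segment ℝ a b, z ∈ N ∧ quad u z (b - a) ≤ ℓ ^ 2

/-- `Reach u N a c r`: a polygonal path of total cost at most `r` joins `a` to `c` in `N`. -/
inductive Reach (u : (Fin n → ℝ) → ℝ) (N : Set (Fin n → ℝ)) :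
    (Fin n → ℝ) → (Fin n → ℝ) → ℝ → Prop
  | nil (a : Fin n → ℝ) {r : ℝ} (hr : 0 ≤ r) : Reach u N a a r
  | cons {a b c : Fin n → ℝ} {ℓ r : ℝ} (h : IsStep u N a b ℓ) (h' : Reach u N b c r) :
      Reach u N a c (ℓ + r)

variable {N : Set (Fin n → ℝ)} {u : (Fin n → ℝ) → ℝ} {a b c : Fin n → ℝ} {ℓ r s : ℝ}

lemma IsStep.sub (h : IsStep u N a b ℓ) {α β : ℝ} (hα : 0 ≤ α) (hαβ : α ≤ β) (hβ : β ≤ 1) :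
    IsStep u N (AffineMap.lineMap a b α) (AffineMap.lineMap a b β) ((β - α) * ℓ) := by
  refine ⟨mul_nonneg (sub_nonneg.2 hαβ) h.1, fun z hz => ?_⟩
  have mem : ∀ θ : ℝ, 0 ≤ θ → θ ≤ 1 → AffineMap.lineMap a b θ ∈ segment ℝ a b := fun θ h0 h1 => by
    rw [segment_eq_image_lineMap]; exact ⟨θ, ⟨h0, h1⟩, rfl⟩
  have hz' : z ∈ segment ℝ a b := (convex_segment a b).segment_subset
    (mem α hα (hαβ.trans hβ)) (mem β (hα.trans hαβ) hβ) hz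
  have e : (AffineMap.lineMap a b β : Fin n → ℝ) - AffineMap.lineMap a b α
      = (β - α) • (b - a) := by
    simp only [AffineMap.lineMap_apply_module']; module
  rw [e, quad_smul, mul_pow]
  exact ⟨(h.2 z hz').1, mul_le_mul_of_nonneg_left (h.2 z hz').2 (sq_nonneg _)⟩

lemma Reach.nonneg (h : Reach u N a c r) : 0 ≤ r := by
  induction h with
  | nil _ hr => exact hr
  | cons h _ ih => exact add_nonneg h.1 ih

lemma Reach.mono (h : Reach u N a c r) (hrs : r ≤ s) : Reach u N a c s := by
  induction h generalizing s with
  | nil a hr => exact .nil a (hr.trans hrs)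
  | @cons _ _ _ ℓ _ h _ ih =>
    have := Reach.cons h (ih (s := s - ℓ) (by linarith))
    rwa [add_sub_cancel] at this

lemma IsStep.reach (h : IsStep u N a b ℓ) : Reach u N a b ℓ := by
  simpa using Reach.cons h (.nil b le_rfl)

lemma Reach.trans (h : Reach u N a b r) (h' : Reach u N b c s) : Reach u N a c (r + s) := by
  induction h with
  | nil a hr => exact h'.mono (by linarith)
  | cons h _ ih => rw [add_assoc]; exact .cons h (ih h')

lemma Reach.mem (h : Reach u N a c r) (ha : a ∈ N) : c ∈ N := by
  induction h with
  | nil a hr => exact ha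
  | cons h _ ih => exact ih (h.2 _ (right_mem_segment ℝ _ _)).1

lemma Reach.split (h : Reach u N a c r) (hs : 0 ≤ s) (hsr : s ≤ r) :
    ∃ z, Reach u N a z s ∧ Reach u N z c (r - s) := by
  induction h generalizing s with
  | nil a hr => exact ⟨a, .nil a hs, .nil a (by linarith)⟩
  | @cons a b c ℓ r h h' ih =>
    rcases le_or_gt ℓ s with hℓ | hℓ
    · obtain ⟨z, h1, h2⟩ := ih (s := s - ℓ) (by linarith) (by linarith)
      refine ⟨z, ?_, h2.mono (by linarith)⟩
      have := Reach.cons h h1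
      rwa [add_sub_cancel] at this
    · have hℓ0 : 0 < ℓ := hs.trans_lt hℓ
      have hθ : s / ℓ ≤ 1 := (div_le_one hℓ0).2 hℓ.le
      have h1 := h.sub le_rfl (div_nonneg hs hℓ0.le) hθ
      have h2 := h.sub (div_nonneg hs hℓ0.le) hθ le_rfl
      rw [AffineMap.lineMap_apply_zero, sub_zero, div_mul_cancel₀ _ hℓ0.ne'] at h1
      rw [AffineMap.lineMap_apply_one, sub_mul, one_mul, div_mul_cancel₀ _ hℓ0.ne'] at h2
      exact ⟨_, h1.reach, (Reach.cons h2 h').mono (by linarith)⟩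

lemma continuousOn_quad (hN : IsOpen N) (hu : ContDiffOn ℝ (⊤ : ℕ∞) u N) :
    ContinuousOn (fun q : (Fin n → ℝ) × (Fin n → ℝ) => quad u q.1 q.2) (N ×ˢ Set.univ) := by
  have : ∀ i j, ContinuousOn (fun q : (Fin n → ℝ) × (Fin n → ℝ) => hessian u q.1 i j)
      (N ×ˢ Set.univ) := fun i j =>
    (contDiffOn_pd hN (contDiffOn_pd hN hu j) i).continuousOn.comp continuousOn_fst
      fun q hq => hq.1
  simp only [quad_eq_sum]
  fun_prop

lemma quad_pos (hpos : ∀ x ∈ N, (hessian u x).PosDef) {z w : Fin n → ℝ} (hz : z ∈ N)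
    (hw : w ≠ 0) : 0 < quad u z w := by
  simpa [quad] using (hpos z hz).dotProduct_mulVec_pos hw

lemma quad_nonneg (hpos : ∀ x ∈ N, (hessian u x).PosDef) {z : Fin n → ℝ} (hz : z ∈ N)
    (w : Fin n → ℝ) : 0 ≤ quad u z w := by
  simpa [quad] using (hpos z hz).posSemidef.dotProduct_mulVec_nonneg w

lemma quad_eq_norm_sq_mul (u : (Fin n → ℝ) → ℝ) (z : Fin n → ℝ) {w : Fin n → ℝ} (hw : w ≠ 0) :
    quad u z w = quad u z (‖w‖⁻¹ • w) * ‖w‖ ^ 2 := by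
  have : ‖w‖ ≠ 0 := norm_ne_zero_iff.2 hw
  rw [quad_smul]; field_simp

/-- The Hessian metric is uniformly comparable to the norm on compact sets: lower bound. -/
lemma exists_quad_lower (hN : IsOpen N) (hu : ContDiffOn ℝ (⊤ : ℕ∞) u N)
    (hpos : ∀ x ∈ N, (hessian u x).PosDef) {K : Set (Fin n → ℝ)} (hK : IsCompact K)
    (hKN : K ⊆ N) : ∃ l > 0, ∀ z ∈ K, ∀ w, l ^ 2 * ‖w‖ ^ 2 ≤ quad u z w := by
  obtain ⟨q, hq, h⟩ := (hK.prod (isCompact_sphere (0 : Fin n → ℝ) 1)).exists_forall_le'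
    ((continuousOn_quad hN hu).mono (Set.prod_mono hKN (Set.subset_univ _))) (a := 0)
    fun q hq => quad_pos hpos (hKN hq.1) (by
      rintro h0; have := hq.2; simp [h0] at this)
  refine ⟨Real.sqrt q, Real.sqrt_pos.2 hq, fun z hz w => ?_⟩
  rcases eq_or_ne w 0 with rfl | hw
  · simp [quad]
  · rw [quad_eq_norm_sq_mul u z hw, Real.sq_sqrt hq.le]
    refine mul_le_mul_of_nonneg_right (h (z, ‖w‖⁻¹ • w) ⟨hz, ?_⟩) (sq_nonneg _)
    simp [norm_smul, hw]

/-- The Hessian metric is uniformly comparable to the norm on compact sets: upper bound. -/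
lemma exists_quad_upper (hN : IsOpen N) (hu : ContDiffOn ℝ (⊤ : ℕ∞) u N)
    {K : Set (Fin n → ℝ)} (hK : IsCompact K)
    (hKN : K ⊆ N) : ∃ L > 0, ∀ z ∈ K, ∀ w, quad u z w ≤ L ^ 2 * ‖w‖ ^ 2 := by
  obtain ⟨q, h⟩ := (hK.prod (isCompact_sphere (0 : Fin n → ℝ) 1)).bddAbove_image
    ((continuousOn_quad hN hu).mono (Set.prod_mono hKN (Set.subset_univ _)))
  refine ⟨|q| + 1, by positivity, fun z hz w => ?_⟩
  rcases eq_or_ne w 0 with rfl | hw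
  · simp [quad]
  · rw [quad_eq_norm_sq_mul u z hw]
    refine mul_le_mul_of_nonneg_right (le_trans (h ⟨(z, ‖w‖⁻¹ • w), ⟨hz, ?_⟩, rfl⟩) ?_)
      (sq_nonneg _)
    · simp [norm_smul, hw]
    · nlinarith [le_abs_self q, abs_nonneg q]

lemma Reach.mem_closedBall {K : Set (Fin n → ℝ)} {l : ℝ} (hl : 0 < l)
    (hK : ∀ z ∈ K, ∀ w, l ^ 2 * ‖w‖ ^ 2 ≤ quad u z w) (h : Reach u N a c r) {ρ : ℝ}
    (hρ : r ≤ l * ρ) (hball : Metric.closedBall a ρ ⊆ K) : c ∈ Metric.closedBall a ρ := by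
  induction h generalizing ρ with
  | nil a hr =>
    exact Metric.mem_closedBall_self (nonneg_of_mul_nonneg_right (hr.trans hρ) hl)
  | @cons a b c ℓ r h h' ih =>
    have hρ0 : 0 ≤ ρ := nonneg_of_mul_nonneg_right ((Reach.cons h h').nonneg.trans hρ) hl
    have h1 : l ^ 2 * ‖b - a‖ ^ 2 ≤ ℓ ^ 2 :=
      (hK a (hball (Metric.mem_closedBall_self hρ0)) _).trans (h.2 a (left_mem_segment ℝ a b)).2
    rw [← mul_pow] at h1
    have h2 : l * ‖b - a‖ ≤ ℓ := (pow_le_pow_iff_left₀ (by positivity) h.1 two_ne_zero).1 h1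
    have h3 : dist b a ≤ ℓ / l := by
      rw [dist_eq_norm, le_div_iff₀ hl]; linarith
    have hsub : Metric.closedBall b (ρ - ℓ / l) ⊆ Metric.closedBall a ρ :=
      Metric.closedBall_subset_closedBall' (by linarith)
    refine hsub (ih ?_ (hsub.trans hball))
    rw [mul_sub, mul_div_cancel₀ _ hl.ne']
    linarith

/-- Points of a compact set can only reach a slightly larger compact set at small cost. -/
lemma exists_reach_local (hN : IsOpen N) (hu : ContDiffOn ℝ (⊤ : ℕ∞) u N)
    (hpos : ∀ x ∈ N, (hessian u x).PosDef) {K : Set (Fin n → ℝ)} (hK : IsCompact K)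
    (hKN : K ⊆ N) : ∃ ε > 0, ∃ K' : Set (Fin n → ℝ), IsCompact K' ∧ K' ⊆ N ∧
      ∀ z ∈ K, ∀ x, Reach u N z x ε → x ∈ K' := by
  obtain ⟨δ, hδ, hsub⟩ := hK.exists_cthickening_subset_open hN hKN
  obtain ⟨l, hl, hlow⟩ := exists_quad_lower hN hu hpos hK.cthickening hsub
  refine ⟨l * δ, mul_pos hl hδ, _, hK.cthickening, hsub, fun z hz x hx => ?_⟩
  have hball := Metric.closedBall_subset_cthickening hz δ
  exact hball (hx.mem_closedBall hl hlow le_rfl hball)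

lemma exists_nhds_isStep (hN : IsOpen N) (hu : ContDiffOn ℝ (⊤ : ℕ∞) u N) {w : Fin n → ℝ}
    (hw : w ∈ N) {η : ℝ} (hη : 0 < η) :
    ∃ U ∈ 𝓝 w, ∀ y ∈ U, ∀ z ∈ U, IsStep u N y z η := by
  obtain ⟨δ, hδ, hsub⟩ := Metric.nhds_basis_closedBall.mem_iff.1 (hN.mem_nhds hw)
  obtain ⟨L, hL, hup⟩ := exists_quad_upper hN hu (isCompact_closedBall w δ) hsub
  have hρ : 0 < min δ (η / (2 * L)) := lt_min hδ (by positivity)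
  refine ⟨_, Metric.closedBall_mem_nhds w hρ, fun y hy z hz => ⟨hη.le, fun x hx => ?_⟩⟩
  have hx' := Metric.closedBall_subset_closedBall (min_le_left δ (η / (2 * L)))
    ((convex_closedBall w _).segment_subset hy hz hx)
  refine ⟨hsub hx', (hup x hx' _).trans ?_⟩
  rw [← mul_pow]
  refine pow_le_pow_left₀ (by positivity) ?_ 2
  have h1 : ‖z - y‖ ≤ η / (2 * L) + η / (2 * L) := by
    rw [← dist_eq_norm]
    exact (dist_triangle_right z y w).trans (add_le_add
      ((Metric.mem_closedBall.1 hz).trans (min_le_right _ _))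
      ((Metric.mem_closedBall.1 hy).trans (min_le_right _ _)))
  calc L * ‖z - y‖ ≤ L * (η / (2 * L) + η / (2 * L)) := by gcongr
    _ = η := by field_simp; ring

/-- The points reachable from `a` at cost `r` lie in a compact subset of `N`. -/
def Confined (u : (Fin n → ℝ) → ℝ) (N : Set (Fin n → ℝ)) (a : Fin n → ℝ) (r : ℝ) : Prop :=
  ∃ K : Set (Fin n → ℝ), IsCompact K ∧ K ⊆ N ∧ ∀ x, Reach u N a x r → x ∈ K

lemma Confined.mono (h : Confined u N a r) (hsr : s ≤ r) : Confined u N a s :=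
  let ⟨K, hK, hKN, hr⟩ := h
  ⟨K, hK, hKN, fun x hx => hr x (hx.mono hsr)⟩

lemma Confined.add (hN : IsOpen N) (hu : ContDiffOn ℝ (⊤ : ℕ∞) u N) {t η : ℝ} (hs : 0 ≤ s)
    (ht : 0 ≤ t) (hη : 0 < η) (h : Confined u N a s)
    (h' : ∀ z, Reach u N a z s → Confined u N z (t + η)) : Confined u N a (s + t) := by
  obtain ⟨K, hK, hKN, hr⟩ := h
  have key : ∃ K' : Set (Fin n → ℝ), IsCompact K' ∧ K' ⊆ N ∧
      ∀ y ∈ K, Reach u N a y s → ∀ x, Reach u N y x t → x ∈ K' := by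
    refine hK.induction_on (p := fun S => ∃ K' : Set (Fin n → ℝ), IsCompact K' ∧ K' ⊆ N ∧
      ∀ y ∈ S, Reach u N a y s → ∀ x, Reach u N y x t → x ∈ K') ?_ ?_ ?_ ?_
    · exact ⟨∅, isCompact_empty, Set.empty_subset _, fun y hy => absurd hy (Set.notMem_empty y)⟩
    · rintro S T hST ⟨K', h1, h2, h3⟩
      exact ⟨K', h1, h2, fun y hy => h3 y (hST hy)⟩
    · rintro S T ⟨K₁, h1, h2, h3⟩ ⟨K₂, k1, k2, k3⟩
      refine ⟨K₁ ∪ K₂, h1.union k1, Set.union_subset h2 k2, fun y hy hay x hx => ?_⟩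
      rcases hy with hy | hy
      · exact Or.inl (h3 y hy hay x hx)
      · exact Or.inr (k3 y hy hay x hx)
    · intro w hw
      obtain ⟨U, hU, hstep⟩ := exists_nhds_isStep hN hu (hKN hw) hη
      refine ⟨U, mem_nhdsWithin_of_mem_nhds hU, ?_⟩
      by_cases hex : ∃ z ∈ U, Reach u N a z s
      · obtain ⟨z, hzU, hz⟩ := hex
        obtain ⟨K', h1, h2, h3⟩ := h' z hz
        refine ⟨K', h1, h2, fun y hy _ x hx => h3 x ?_⟩
        rw [add_comm]
        exact .cons (hstep z hzU y hy) hx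
      · exact ⟨∅, isCompact_empty, Set.empty_subset _, fun y hy hay => absurd ⟨y, hy, hay⟩ hex⟩
  obtain ⟨K', h1, h2, h3⟩ := key
  refine ⟨K', h1, h2, fun x hx => ?_⟩
  obtain ⟨z, hz, hzx⟩ := hx.split hs (by linarith)
  exact h3 z (hr z hz) hz x (by simpa using hzx)

lemma exists_reach_not_confined (hN : IsOpen N) (hu : ContDiffOn ℝ (⊤ : ℕ∞) u N) (hr : 0 < r)
    (h : ¬ Confined u N a r) : ∃ b, Reach u N a b r ∧ ¬ Confined u N b (r / 2) := by
  by_contra! hcon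
  have h1 : Confined u N a (r / 2 + r / 4) :=
    (hcon a (.nil a hr.le)).add hN hu (by linarith) (by linarith) (η := r / 4) (by linarith)
      fun z hz => (hcon z (hz.mono (by linarith))).mono (by linarith)
  have h2 : Confined u N a (r / 2 + r / 4 + r / 4) :=
    h1.add hN hu (by linarith) (by linarith) (η := r / 4) (by linarith)
      fun z hz => (hcon z (hz.mono (by linarith))).mono (by linarith)
  exact h (h2.mono (by linarith))

end Reachability

section Curves

variable {N : Set (Fin n → ℝ)} {u : (Fin n → ℝ) → ℝ} {a b c : Fin n → ℝ} {ℓ r s σ τ υ S : ℝ}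

/-- A `C¹` curve in `N` that rests at `a` before time `σ`, rests at `c` after time `τ`, and has
speed at most `S`. -/
structure RestCurve (u : (Fin n → ℝ) → ℝ) (N : Set (Fin n → ℝ)) (S : ℝ) (a c : Fin n → ℝ)
    (σ τ : ℝ) (γ : ℝ → Fin n → ℝ) : Prop where
  contDiff : ContDiff ℝ 1 γ
  left : ∀ t ≤ σ, γ t = a
  right : ∀ t, τ ≤ t → γ t = c
  mem : ∀ t, γ t ∈ N
  speed : ∀ t, quad u (γ t) (deriv γ t) ≤ S ^ 2

lemma deriv_eq_zero_of_eq_const_right {γ : ℝ → Fin n → ℝ} (hγ : ContDiff ℝ 1 γ)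
    (h : ∀ t, τ ≤ t → γ t = c) : deriv γ τ = 0 := by
  have h1 : HasDerivWithinAt γ (deriv γ τ) (Set.Ici τ) τ :=
    ((hγ.differentiable one_ne_zero) τ).hasDerivAt.hasDerivWithinAt
  have h2 : HasDerivWithinAt γ 0 (Set.Ici τ) τ :=
    (hasDerivWithinAt_const τ _ c).congr (fun t ht => h t ht) (h τ le_rfl)
  exact (uniqueDiffWithinAt_Ici τ).eq_deriv _ h1 h2

lemma deriv_eq_zero_of_eq_const_left {γ : ℝ → Fin n → ℝ} (hγ : ContDiff ℝ 1 γ)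
    (h : ∀ t ≤ τ, γ t = c) : deriv γ τ = 0 := by
  have h1 : HasDerivWithinAt γ (deriv γ τ) (Set.Iic τ) τ :=
    ((hγ.differentiable one_ne_zero) τ).hasDerivAt.hasDerivWithinAt
  have h2 : HasDerivWithinAt γ 0 (Set.Iic τ) τ :=
    (hasDerivWithinAt_const τ _ c).congr (fun t ht => h t ht) (h τ le_rfl)
  exact (uniqueDiffWithinAt_Iic τ).eq_deriv _ h1 h2

lemma RestCurve.const (ha : a ∈ N) : RestCurve u N S a a σ τ fun _ => a where
  contDiff := contDiff_const
  left _ _ := rfl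
  right _ _ := rfl
  mem _ := ha
  speed t := by simp [quad, sq_nonneg]

section Glue

variable {γ₁ γ₂ : ℝ → Fin n → ℝ}

lemma RestCurve.glue_eq_left (h₂ : RestCurve u N S b c τ υ γ₂) {t : ℝ} (ht : t ≤ τ) :
    γ₁ t + (γ₂ t - b) = γ₁ t := by
  rw [h₂.left t ht, sub_self, add_zero]

lemma RestCurve.glue_eq_right (h₁ : RestCurve u N S a b σ τ γ₁) {t : ℝ} (ht : τ ≤ t) :
    γ₁ t + (γ₂ t - b) = γ₂ t := by
  rw [h₁.right t ht, add_sub_cancel]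

lemma RestCurve.glue (hστ : σ ≤ τ) (hτυ : τ ≤ υ) (h₁ : RestCurve u N S a b σ τ γ₁)
    (h₂ : RestCurve u N S b c τ υ γ₂) :
    RestCurve u N S a c σ υ fun t => γ₁ t + (γ₂ t - b) where
  contDiff := h₁.contDiff.add (h₂.contDiff.sub contDiff_const)
  left t ht := by rw [h₂.glue_eq_left (ht.trans hστ), h₁.left t ht]
  right t ht := by rw [h₁.glue_eq_right (hτυ.trans ht), h₂.right t ht]
  mem t := by
    rcases le_total t τ with ht | ht
    · rw [h₂.glue_eq_left ht]; exact h₁.mem t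
    · rw [h₁.glue_eq_right ht]; exact h₂.mem t
  speed t := by
    rcases lt_trichotomy t τ with ht | rfl | ht
    · have : (fun t => γ₁ t + (γ₂ t - b)) =ᶠ[𝓝 t] γ₁ := by
        filter_upwards [Iio_mem_nhds ht] with s hs using h₂.glue_eq_left (le_of_lt hs)
      rw [this.deriv_eq, h₂.glue_eq_left ht.le]
      exact h₁.speed t
    · have h1 := ((h₁.contDiff.differentiable one_ne_zero) t).hasDerivAt
      have h2 := ((h₂.contDiff.differentiable one_ne_zero) t).hasDerivAt
      rw [deriv_eq_zero_of_eq_const_right h₁.contDiff h₁.right] at h1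
      rw [deriv_eq_zero_of_eq_const_left h₂.contDiff h₂.left] at h2
      rw [(h1.fun_add (h2.sub_const b)).deriv]
      simp [quad, sq_nonneg]
    · have : (fun t => γ₁ t + (γ₂ t - b)) =ᶠ[𝓝 t] γ₂ := by
        filter_upwards [Ioi_mem_nhds ht] with s hs using h₁.glue_eq_right (le_of_lt hs)
      rw [this.deriv_eq, h₁.glue_eq_right ht.le]
      exact h₂.speed t

end Glue

lemma exists_deriv_smoothTransition_bound :
    ∃ M > 0, ∀ t, |deriv Real.smoothTransition t| ≤ M := by
  have hc : Continuous (deriv Real.smoothTransition) :=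
    (Real.smoothTransition.contDiff (n := 1)).continuous_deriv le_rfl
  obtain ⟨M, hM⟩ := (isCompact_Icc (a := (0 : ℝ)) (b := 1)).exists_bound_of_continuousOn
    hc.continuousOn
  refine ⟨|M| + 1, by positivity, fun t => ?_⟩
  by_cases ht : t ∈ Set.Icc (0 : ℝ) 1
  · exact ((hM t ht).trans (le_abs_self M)).trans (by linarith)
  · have h0 : deriv Real.smoothTransition t = 0 := by
      rw [Set.mem_Icc, not_and_or, not_le, not_le] at ht
      rcases ht with ht | ht
      · have : Real.smoothTransition =ᶠ[𝓝 t] fun _ => 0 := by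
          filter_upwards [Iio_mem_nhds ht] with s hs
          exact Real.smoothTransition.zero_of_nonpos (le_of_lt hs)
        rw [this.deriv_eq, deriv_const]
      · have : Real.smoothTransition =ᶠ[𝓝 t] fun _ => 1 := by
          filter_upwards [Ioi_mem_nhds ht] with s hs
          exact Real.smoothTransition.one_of_one_le (le_of_lt hs)
        rw [this.deriv_eq, deriv_const]
    rw [h0, abs_zero]; positivity

lemma IsStep.exists_restCurve {M : ℝ} (hM : ∀ t, |deriv Real.smoothTransition t| ≤ M)
    (h : IsStep u N a b ℓ) (hστ : σ < τ) (hS : M * ℓ ≤ S * (τ - σ)) :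
    ∃ γ, RestCurve u N S a b σ τ γ ∧ ∀ t, Reach u N (γ t) b ℓ := by
  have hd : 0 < τ - σ := sub_pos.2 hστ
  set θ : ℝ → ℝ := fun t => Real.smoothTransition ((t - σ) / (τ - σ)) with hθ
  have hθC : ContDiff ℝ 1 θ :=
    Real.smoothTransition.contDiff.comp ((contDiff_id.sub contDiff_const).div_const _)
  have hθd : ∀ t, HasDerivAt θ (deriv Real.smoothTransition ((t - σ) / (τ - σ)) / (τ - σ)) t := by
    intro t
    have h1 := (((Real.smoothTransition.contDiff (n := 1)).differentiable one_ne_zero)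
      ((t - σ) / (τ - σ))).hasDerivAt
    have h2 : HasDerivAt (fun t : ℝ => (t - σ) / (τ - σ)) (1 / (τ - σ)) t :=
      ((hasDerivAt_id t).sub_const σ).div_const _
    have := h1.comp t h2
    rwa [mul_one_div] at this
  have hγd : ∀ t, HasDerivAt (fun t => a + θ t • (b - a))
      ((deriv Real.smoothTransition ((t - σ) / (τ - σ)) / (τ - σ)) • (b - a)) t := fun t =>
    ((hθd t).smul_const (b - a)).const_add a
  have hline : ∀ t, a + θ t • (b - a) = AffineMap.lineMap a b (θ t) := fun t => by
    rw [AffineMap.lineMap_apply_module', add_comm]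
  have h0 : ∀ t, 0 ≤ θ t := fun t => Real.smoothTransition.nonneg _
  have h1 : ∀ t, θ t ≤ 1 := fun t => Real.smoothTransition.le_one _
  have hseg : ∀ t, a + θ t • (b - a) ∈ segment ℝ a b := fun t => by
    rw [hline, segment_eq_image_lineMap]; exact ⟨_, ⟨h0 t, h1 t⟩, rfl⟩
  refine ⟨fun t => a + θ t • (b - a), ⟨?_, ?_, ?_, ?_, ?_⟩, ?_⟩
  · exact contDiff_const.add (hθC.smul contDiff_const)
  · intro t ht
    have : θ t = 0 := Real.smoothTransition.zero_of_nonpos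
      (div_nonpos_of_nonpos_of_nonneg (by linarith) hd.le)
    simp [this]
  · intro t ht
    have : θ t = 1 := Real.smoothTransition.one_of_one_le ((one_le_div hd).2 (by linarith))
    simp [this]
  · exact fun t => (h.2 _ (hseg t)).1
  · intro t
    rw [(hγd t).deriv, quad_smul]
    set D := deriv Real.smoothTransition ((t - σ) / (τ - σ)) / (τ - σ) with hD
    have hDS : |D| * ℓ ≤ S := by
      rw [hD, abs_div, abs_of_pos hd, div_mul_eq_mul_div, div_le_iff₀ hd]
      exact (mul_le_mul_of_nonneg_right (hM _) h.1).trans hS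
    calc D ^ 2 * quad u (a + θ t • (b - a)) (b - a) ≤ D ^ 2 * ℓ ^ 2 := by
          gcongr; exact (h.2 _ (hseg t)).2
      _ = (|D| * ℓ) ^ 2 := by rw [mul_pow, sq_abs]
      _ ≤ S ^ 2 := pow_le_pow_left₀ (mul_nonneg (abs_nonneg _) h.1) hDS 2
  · intro t
    have := h.sub (h0 t) (h1 t) le_rfl
    rw [AffineMap.lineMap_apply_one, ← hline] at this
    refine this.reach.mono ?_
    nlinarith [mul_nonneg (h0 t) h.1]

lemma Reach.exists_restCurve {M : ℝ} (hM0 : 0 < M)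
    (hM : ∀ t, |deriv Real.smoothTransition t| ≤ M) (hS0 : 0 < S)
    (h : Reach u N a c r) (ha : a ∈ N) (hστ : σ < τ) (hS : M * r < S * (τ - σ)) :
    ∃ γ, RestCurve u N S a c σ τ γ ∧ ∀ t, Reach u N (γ t) c r := by
  induction h generalizing σ with
  | nil a hr => exact ⟨_, .const ha, fun _ => .nil a hr⟩
  | @cons a b c ℓ r h h' ih =>
    set g := (S * (τ - σ) - M * (ℓ + r)) / 2 with hg
    have hg0 : 0 < g := by rw [hg]; linarith
    set ρ := σ + (M * ℓ + g) / S with hρ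
    have e1 : S * (ρ - σ) = M * ℓ + g := by rw [hρ]; field_simp; ring
    have e2 : S * (τ - ρ) = M * r + g := by
      have : S * (τ - ρ) = S * (τ - σ) - S * (ρ - σ) := by ring
      rw [this, e1, hg]; ring
    have hσρ : σ < ρ := by
      have : 0 < S * (ρ - σ) := by rw [e1]; nlinarith [mul_nonneg hM0.le h.1]
      linarith [pos_of_mul_pos_right this hS0.le]
    have hρτ : ρ < τ := by
      have : 0 < S * (τ - ρ) := by rw [e2]; nlinarith [mul_nonneg hM0.le h'.nonneg]
      linarith [pos_of_mul_pos_right this hS0.le]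
    obtain ⟨γ₁, h1, k1⟩ := h.exists_restCurve hM hσρ (S := S) (by linarith)
    obtain ⟨γ₂, h2, k2⟩ := ih (h.2 _ (right_mem_segment ℝ _ _)).1 hρτ (by linarith)
    refine ⟨_, h1.glue hσρ.le hρτ.le h2, fun t => ?_⟩
    rcases le_total t ρ with ht | ht
    · rw [h2.glue_eq_left ht]; exact (k1 t).trans h'
    · rw [h1.glue_eq_right ht]; exact (k2 t).mono (by linarith [h.1])

/-- Concatenation of infinitely many resting curves with times accumulating at `1`. -/
lemma exists_concatenation {q : ℕ → Fin n → ℝ} {T : ℕ → ℝ} (hT : StrictMono T)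
    (hT0 : T 0 = 0) (hT_lt : ∀ k, T k < 1) (hT1 : ∀ t < 1, ∃ k, t < T k) (hq : q 0 ∈ N)
    {γ : ℕ → ℝ → Fin n → ℝ} (h : ∀ k, RestCurve u N S (q k) (q (k + 1)) (T k) (T (k + 1)) (γ k)) :
    ∃ Γ : ℝ → Fin n → ℝ, (∀ t < 1, ContDiffAt ℝ 1 Γ t) ∧ (∀ t < 1, Γ t ∈ N) ∧
      (∀ t < 1, quad u (Γ t) (deriv Γ t) ≤ S ^ 2) ∧
      ∀ k t, T k ≤ t → t ≤ T (k + 1) → Γ t = γ k t := by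
  let G : ℕ → ℝ → Fin n → ℝ := fun k =>
    Nat.rec (fun _ => q 0) (fun j g t => g t + (γ j t - q j)) k
  have hG : ∀ k, RestCurve u N S (q 0) (q k) 0 (T k) (G k) := by
    intro k
    induction k with
    | zero => exact .const hq
    | succ k ih =>
      exact ih.glue (hT0 ▸ hT.monotone (Nat.zero_le k)) (hT (Nat.lt_succ_self k)).le (h k)
  have hstep : ∀ k t, t ≤ T k → ∀ j, G (k + j) t = G k t := by
    intro k t ht j
    induction j with
    | zero => rfl
    | succ j ih =>
      rw [← ih]
      exact (h (k + j)).glue_eq_left (ht.trans (hT.monotone (Nat.le_add_right k j)))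
  have hagree : ∀ k l t, t ≤ T k → t ≤ T l → G k t = G l t := by
    intro k l t hk hl
    rcases le_total k l with hkl | hkl
    · obtain ⟨j, rfl⟩ := Nat.exists_eq_add_of_le hkl
      exact (hstep k t hk j).symm
    · obtain ⟨j, rfl⟩ := Nat.exists_eq_add_of_le hkl
      exact hstep l t hl j
  choose! κ hκ using hT1
  let Γ : ℝ → Fin n → ℝ := fun t => G (κ t) t
  have hΓ : ∀ k t, t ≤ T k → Γ t = G k t := fun k t ht =>
    hagree _ _ t (hκ t (ht.trans_lt (hT_lt k))).le ht
  have hev : ∀ t < 1, ∃ k, Γ =ᶠ[𝓝 t] G k := fun t ht => ⟨κ t, by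
    filter_upwards [Iio_mem_nhds (hκ t ht)] with s hs using hΓ _ s (le_of_lt hs)⟩
  refine ⟨Γ, fun t ht => ?_, fun t ht => ?_, fun t ht => ?_, fun k t h1 h2 => ?_⟩
  · obtain ⟨k, hk⟩ := hev t ht
    exact (hG k).contDiff.contDiffAt.congr_of_eventuallyEq hk
  · obtain ⟨k, hk⟩ := hev t ht
    rw [hk.self_of_nhds]; exact (hG k).mem t
  · obtain ⟨k, hk⟩ := hev t ht
    rw [hk.self_of_nhds, hk.deriv_eq]; exact (hG k).speed t
  · rw [hΓ _ _ h2]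
    exact (hG k).glue_eq_right h1

/-- Completeness confines the points reachable at bounded cost to a compact subset of `N`. -/
theorem confined_of_complete (hN : IsOpen N) (hu : ContDiffOn ℝ (⊤ : ℕ∞) u N)
    (hpos : ∀ x ∈ N, (hessian u x).PosDef) (hcomplete : HessComplete u N) (ha : a ∈ N) (r : ℝ) :
    Confined u N a r := by
  suffices H : ∀ r > 0, Confined u N a r from
    (H (|r| + 1) (by positivity)).mono ((le_abs_self r).trans (by linarith))
  clear r
  intro r hr
  by_contra hbad
  set ρ : ℕ → ℝ := fun k => r * (1 / 2) ^ k with hρ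
  have hρ0 : ∀ k, 0 < ρ k := fun k => by positivity
  have hρs : ∀ k, ρ (k + 1) = ρ k / 2 := fun k => by simp only [hρ, pow_succ]; ring
  let X : ℕ → Type := fun k => {b : Fin n → ℝ // b ∈ N ∧ ¬ Confined u N b (ρ k)}
  have hnext : ∀ k (b : X k), ∃ b' : X (k + 1), Reach u N b.1 b'.1 (ρ k) := by
    rintro k ⟨b, hb, hbk⟩
    obtain ⟨b', h1, h2⟩ := exists_reach_not_confined hN hu (hρ0 k) hbk
    exact ⟨⟨b', h1.mem hb, by rwa [hρs]⟩, h1⟩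
  choose next hnext using hnext
  let Q : ∀ k, X k := fun k => Nat.rec ⟨a, ha, by simpa [hρ] using hbad⟩ next k
  set q : ℕ → Fin n → ℝ := fun k => (Q k).1 with hq
  have hqN : ∀ k, q k ∈ N := fun k => (Q k).2.1
  have hqbad : ∀ k, ¬ Confined u N (q k) (ρ k) := fun k => (Q k).2.2
  have hqr : ∀ k, Reach u N (q k) (q (k + 1)) (ρ k) := fun k => hnext k (Q k)
  obtain ⟨M, hM0, hM⟩ := exists_deriv_smoothTransition_bound
  set T : ℕ → ℝ := fun k => 1 - (1 / 2) ^ k with hT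
  have hTs : ∀ k, T (k + 1) - T k = (1 / 2) ^ k / 2 := fun k => by
    simp only [hT, pow_succ]; ring
  have hTmono : StrictMono T := strictMono_nat_of_lt_succ fun k => by
    have : (0 : ℝ) < (1 / 2) ^ k / 2 := by positivity
    linarith [hTs k]
  have hT1 : ∀ t < (1 : ℝ), ∃ k, t < T k := fun t ht => by
    obtain ⟨k, hk⟩ := exists_pow_lt_of_lt_one (sub_pos.2 ht) (by norm_num : (1 / 2 : ℝ) < 1)
    exact ⟨k, by simp only [hT]; linarith⟩
  have hTlt : ∀ k, T k < 1 := fun k => sub_lt_self _ (by positivity)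
  set S := 4 * M * r with hS
  have hcurve : ∀ k, ∃ γ, RestCurve u N S (q k) (q (k + 1)) (T k) (T (k + 1)) γ ∧
      ∀ t, Reach u N (γ t) (q (k + 1)) (ρ k) := fun k =>
    (hqr k).exists_restCurve hM0 hM (by positivity) (hqN k) (hTmono (Nat.lt_succ_self k)) (by
      rw [hTs, hS, hρ]
      have : 0 < M * r * (1 / 2) ^ k := by positivity
      linarith)
  choose γ hγ hγr using hcurve
  obtain ⟨Γ, hΓd, hΓN, hΓs, hΓeq⟩ := exists_concatenation hTmono (by simp [hT]) hTlt hT1 (hqN 0) hγ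
  have hlen := hcomplete Γ (fun t ht => (hΓd t ht.2).contDiffWithinAt) (fun t ht => hΓN t ht.2) ?_
  · have hle : ∫⁻ t in Set.Ioo (0 : ℝ) 1, ENNReal.ofReal (Real.sqrt (∑ i, ∑ j,
        hessian u (Γ t) i j * deriv Γ t i * deriv Γ t j))
        ≤ ∫⁻ _ in Set.Ioo (0 : ℝ) 1, ENNReal.ofReal S := by
      refine MeasureTheory.setLIntegral_mono measurable_const fun t ht => ?_
      refine ENNReal.ofReal_le_ofReal ?_
      rw [← quad_eq_sum]
      exact Real.sqrt_le_iff.2 ⟨by positivity, hΓs t ht.2⟩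
    rw [hlen] at hle
    simp at hle
  · intro K hK hKN
    obtain ⟨ε, hε, K', hK', hK'N, hloc⟩ := exists_reach_local hN hu hpos hK hKN
    obtain ⟨J, hJ⟩ := exists_pow_lt_of_lt_one (div_pos hε (mul_pos two_pos hr))
      (by norm_num : (1 / 2 : ℝ) < 1)
    rw [lt_div_iff₀ (by positivity)] at hJ
    refine ⟨T J, ⟨by simpa [hT] using hTmono.monotone (Nat.zero_le J), hTlt J⟩,
      fun t ht htK => ?_⟩
    classical
    have hex : ∃ k, t < T (k + 1) := by
      obtain ⟨k, hk⟩ := hT1 t ht.2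
      exact ⟨k, hk.trans (hTmono (Nat.lt_succ_self k))⟩
    set k := Nat.find hex with hk
    have hk1 : t < T (k + 1) := Nat.find_spec hex
    have hJk : J ≤ k := by
      by_contra hlt
      exact absurd (hk1.trans_le (hTmono.monotone (show k + 1 ≤ J by omega))) (not_lt.2 ht.1.le)
    have hk0 : T k ≤ t := by
      rcases Nat.eq_zero_or_pos k with h0 | h0
      · rw [h0]; exact (hTmono.monotone (Nat.zero_le J)).trans ht.1.le
      · have := Nat.find_min hex (m := k - 1) (by omega)
        rwa [Nat.sub_add_cancel h0, not_lt] at this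
    have hreach := hγr k t
    rw [← hΓeq k t hk0 hk1.le] at hreach
    refine hqbad (k + 1) ⟨K', hK', hK'N, fun x hx => hloc _ htK x ((hreach.trans hx).mono ?_)⟩
    have h1 : (1 / 2 : ℝ) ^ k ≤ (1 / 2) ^ J :=
      pow_le_pow_of_le_one (by norm_num) (by norm_num) hJk
    have h2 := mul_le_mul_of_nonneg_left h1 hr.le
    rw [hρs]
    simp only [hρ]
    linarith [mul_pos hr (show (0 : ℝ) < (1 / 2) ^ J by positivity)]

end Curves

section StepGeometry

variable {N : Set (Fin n → ℝ)} {u : (Fin n → ℝ) → ℝ}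

lemma abs_dotProduct_le (a b : Fin n → ℝ) : |a ⬝ᵥ b| ≤ n * ‖a‖ * ‖b‖ := by
  calc |a ⬝ᵥ b| ≤ ∑ i, |a i * b i| := Finset.abs_sum_le_sum_abs _ _
    _ ≤ ∑ _i : Fin n, ‖a‖ * ‖b‖ := Finset.sum_le_sum fun i _ => by
        rw [abs_mul]
        exact mul_le_mul (norm_le_pi_norm a i) (norm_le_pi_norm b i) (abs_nonneg _)
          (norm_nonneg _)
    _ = n * ‖a‖ * ‖b‖ := by simp [mul_assoc]

/-- A smooth function is uniformly Lipschitz along the segments contained in a compact set. -/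
lemma exists_lipschitz_on_segments (hN : IsOpen N) {f : (Fin n → ℝ) → ℝ}
    (hf : ContDiffOn ℝ (⊤ : ℕ∞) f N) {K : Set (Fin n → ℝ)} (hK : IsCompact K) (hKN : K ⊆ N) :
    ∃ L ≥ 0, ∀ a b, segment ℝ a b ⊆ K → |f b - f a| ≤ L * ‖b - a‖ := by
  have hc : ContinuousOn (fderiv ℝ f) K :=
    (hf.continuousOn_fderiv_of_isOpen hN (by simp)).mono hKN
  obtain ⟨L, hL⟩ := hK.exists_bound_of_continuousOn hc
  refine ⟨|L|, abs_nonneg L, fun a b hab => ?_⟩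
  exact (convex_segment a b).norm_image_sub_le_of_norm_fderiv_le
    (fun z hz => differentiableAt_of_contDiffOn hN hf (hKN (hab hz)))
    (fun z hz => (hL z (hab hz)).trans (le_abs_self L))
    (left_mem_segment ℝ a b) (right_mem_segment ℝ a b)

lemma exists_segment_slope (hN : IsOpen N) {f : (Fin n → ℝ) → ℝ}
    (hf : ContDiffOn ℝ (⊤ : ℕ∞) f N) {a b : Fin n → ℝ} (hab : segment ℝ a b ⊆ N) :
    ∃ z ∈ segment ℝ a b, f b - f a = ∑ i, (b - a) i * pd i f z := by
  have hmem : ∀ t ∈ Set.Icc (0 : ℝ) 1, a + t • (b - a) ∈ segment ℝ a b := fun t ht => by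
    rw [segment_eq_image']; exact ⟨t, ht, rfl⟩
  have hd : ∀ t ∈ Set.Icc (0 : ℝ) 1, HasDerivAt (fun s : ℝ => f (a + s • (b - a)))
      (∑ i, (b - a) i * pd i f (a + t • (b - a))) t := fun t ht =>
    hasDerivAt_line hN hf a (b - a) (hab (hmem t ht))
  obtain ⟨t, ht, h⟩ := exists_hasDerivAt_eq_slope _ _ zero_lt_one
    (fun t ht => (hd t ht).continuousAt.continuousWithinAt)
    (fun t ht => hd t (Set.Ioo_subset_Icc_self ht))
  refine ⟨_, hmem t (Set.Ioo_subset_Icc_self ht), ?_⟩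
  rw [h]; simp

/-- By the mean value theorem the cost of a step is its squared length at an intermediate point. -/
lemma stepCost_eq_quad (hN : IsOpen N) (hu : ContDiffOn ℝ (⊤ : ℕ∞) u N) {a b : Fin n → ℝ}
    (hab : segment ℝ a b ⊆ N) : ∃ z ∈ segment ℝ a b, stepCost u a b = quad u z (b - a) := by
  have hmem : ∀ t ∈ Set.Icc (0 : ℝ) 1, a + t • (b - a) ∈ segment ℝ a b := fun t ht => by
    rw [segment_eq_image']; exact ⟨t, ht, rfl⟩
  have hd : ∀ t ∈ Set.Icc (0 : ℝ) 1, HasDerivAt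
      (fun s : ℝ => ∑ p, (b - a) p * pd p u (a + s • (b - a)))
      (∑ p, (b - a) p * ∑ i, (b - a) i * pd i (pd p u) (a + t • (b - a))) t := fun t ht =>
    HasDerivAt.fun_sum fun p _ =>
      (hasDerivAt_line hN (contDiffOn_pd hN hu p) a (b - a) (hab (hmem t ht))).const_mul _
  obtain ⟨t, ht, h⟩ := exists_hasDerivAt_eq_slope _ _ zero_lt_one
    (fun t ht => (hd t ht).continuousAt.continuousWithinAt)
    (fun t ht => hd t (Set.Ioo_subset_Icc_self ht))
  refine ⟨_, hmem t (Set.Ioo_subset_Icc_self ht), ?_⟩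
  have hcost : stepCost u a b = ∑ p, (b - a) p * ∑ i, (b - a) i *
      pd i (pd p u) (a + t • (b - a)) := by
    rw [h]
    simp [stepCost, coordGrad, dotProduct, mul_sub]
  rw [hcost, quad_eq_sum, Finset.sum_comm]
  refine Finset.sum_congr rfl fun p _ => ?_
  rw [Finset.mul_sum]
  refine Finset.sum_congr rfl fun i _ => ?_
  simp only [hessian, Matrix.of_apply]
  ring

/-- Uniform comparison between the cost of a short step and its infinitesimal counterparts. -/
structure GoodStep (u : (Fin n → ℝ) → ℝ) (N : Set (Fin n → ℝ)) (l Λ : ℝ) (a b : Fin n → ℝ) :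
    Prop where
  segment_subset : segment ℝ a b ⊆ N
  lower_right : ∀ w, l ^ 2 * ‖w‖ ^ 2 ≤ quad u b w
  quad_le : ∀ z ∈ segment ℝ a b, quad u z (b - a) ≤ 2 * stepCost u a b
  norm_le : l ^ 2 * ‖b - a‖ ^ 2 ≤ stepCost u a b
  taylor_left : ‖coordGrad u b - coordGrad u a - hessian u a *ᵥ (b - a)‖ ≤ Λ * ‖b - a‖ ^ 2
  taylor_right : ‖coordGrad u b - coordGrad u a - hessian u b *ᵥ (b - a)‖ ≤ Λ * ‖b - a‖ ^ 2

lemma segment_subset_of_mem {a b z z' : Fin n → ℝ} (hz : z ∈ segment ℝ a b)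
    (hz' : z' ∈ segment ℝ a b) : segment ℝ z z' ⊆ segment ℝ a b :=
  (convex_segment a b).segment_subset hz hz'

lemma norm_sub_le_of_mem_segment {a b z z' : Fin n → ℝ} (hz : z ∈ segment ℝ a b)
    (hz' : z' ∈ segment ℝ a b) : ‖z' - z‖ ≤ ‖b - a‖ := by
  rw [segment_eq_image'] at hz hz'
  obtain ⟨s, hs, rfl⟩ := hz
  obtain ⟨t, ht, rfl⟩ := hz'
  have : a + t • (b - a) - (a + s • (b - a)) = (t - s) • (b - a) := by module
  rw [this, norm_smul]
  refine mul_le_of_le_one_left (norm_nonneg _) ?_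
  rw [Real.norm_eq_abs, abs_le]
  constructor <;> linarith [hs.1, hs.2, ht.1, ht.2]

lemma exists_goodStep (hN : IsOpen N) (hu : ContDiffOn ℝ (⊤ : ℕ∞) u N)
    (hpos : ∀ x ∈ N, (hessian u x).PosDef) {K : Set (Fin n → ℝ)} (hK : IsCompact K)
    (hKN : K ⊆ N) : ∃ l > 0, ∃ Λ ≥ 0, ∃ δ > 0, ∀ a b, segment ℝ a b ⊆ K → ‖b - a‖ ≤ δ →
      GoodStep u N l Λ a b := by
  obtain ⟨l, hl, hlow⟩ := exists_quad_lower hN hu hpos hK hKN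
  choose L hL0 hL using fun i j =>
    exists_lipschitz_on_segments hN (contDiffOn_pd hN (contDiffOn_pd hN hu j) i) hK hKN
  set M := ∑ i, ∑ j, L i j with hM
  have hM0 : 0 ≤ M := Finset.sum_nonneg fun i _ => Finset.sum_nonneg fun j _ => hL0 i j
  have hLM : ∀ i j, L i j ≤ M := fun i j =>
    (Finset.single_le_sum (fun j _ => hL0 i j) (Finset.mem_univ j)).trans
      (Finset.single_le_sum (f := fun i => ∑ j, L i j)
        (fun i _ => Finset.sum_nonneg fun j _ => hL0 i j) (Finset.mem_univ i))
  have hlip : ∀ a b, segment ℝ a b ⊆ K → ∀ i j,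
      |hessian u b i j - hessian u a i j| ≤ M * ‖b - a‖ := fun a b hab i j =>
    (hL i j a b hab).trans (mul_le_mul_of_nonneg_right (hLM i j) (norm_nonneg _))
  have hquad : ∀ a b, segment ℝ a b ⊆ K → ∀ w,
      |quad u b w - quad u a w| ≤ n ^ 2 * M * ‖b - a‖ * ‖w‖ ^ 2 := by
    intro a b hab w
    rw [quad_eq_sum, quad_eq_sum, ← Finset.sum_sub_distrib]
    simp only [← Finset.sum_sub_distrib]
    calc _ ≤ ∑ i, ∑ j, |hessian u b i j * w i * w j - hessian u a i j * w i * w j| :=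
          (Finset.abs_sum_le_sum_abs _ _).trans
            (Finset.sum_le_sum fun i _ => Finset.abs_sum_le_sum_abs _ _)
      _ ≤ ∑ _i : Fin n, ∑ _j : Fin n, M * ‖b - a‖ * (‖w‖ * ‖w‖) := by
          refine Finset.sum_le_sum fun i _ => Finset.sum_le_sum fun j _ => ?_
          rw [mul_assoc, mul_assoc, ← sub_mul, abs_mul, abs_mul]
          exact mul_le_mul (hlip a b hab i j)
            (mul_le_mul (norm_le_pi_norm w i) (norm_le_pi_norm w j) (abs_nonneg _)
              (norm_nonneg _)) (by positivity) (by positivity)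
      _ = n ^ 2 * M * ‖b - a‖ * ‖w‖ ^ 2 := by simp; ring
  have htaylor : ∀ a b, segment ℝ a b ⊆ K → ∀ e ∈ segment ℝ a b,
      ‖coordGrad u b - coordGrad u a - hessian u e *ᵥ (b - a)‖ ≤ n * M * ‖b - a‖ ^ 2 := by
    intro a b hab e he
    refine (pi_norm_le_iff_of_nonneg (by positivity)).2 fun p => ?_
    obtain ⟨z, hz, h⟩ := exists_segment_slope hN (contDiffOn_pd hN hu p) (hab.trans hKN)
    have e1 : (coordGrad u b - coordGrad u a - hessian u e *ᵥ (b - a)) p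
        = ∑ i, (b - a) i * (hessian u z i p - hessian u e i p) := by
      simp only [Pi.sub_apply, coordGrad, mulVec, dotProduct] at h ⊢
      rw [h, ← Finset.sum_sub_distrib]
      refine Finset.sum_congr rfl fun i _ => ?_
      rw [hessian_symm hN hu (hKN (hab he)) p i]
      simp only [hessian, Matrix.of_apply]
      ring
    rw [e1, Real.norm_eq_abs]
    calc _ ≤ ∑ i, |(b - a) i * (hessian u z i p - hessian u e i p)| :=
          Finset.abs_sum_le_sum_abs _ _
      _ ≤ ∑ _i : Fin n, ‖b - a‖ * (M * ‖b - a‖) := by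
          refine Finset.sum_le_sum fun i _ => ?_
          rw [abs_mul]
          refine mul_le_mul (norm_le_pi_norm (b - a) i) ?_ (abs_nonneg _) (norm_nonneg _)
          exact (hlip e z ((segment_subset_of_mem he hz).trans hab) i p).trans
            (mul_le_mul_of_nonneg_left (norm_sub_le_of_mem_segment he hz) hM0)
      _ = n * M * ‖b - a‖ ^ 2 := by simp; ring
  refine ⟨l, hl, n * M, by positivity, l ^ 2 / (n ^ 2 * M + 1), by positivity,
    fun a b hab hδ => ?_⟩
  have hcomp : ∀ z ∈ segment ℝ a b, ∀ z' ∈ segment ℝ a b,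
      quad u z' (b - a) ≤ 2 * quad u z (b - a) := by
    intro z hz z' hz'
    have h1 := (le_abs_self _).trans
      (hquad z z' ((segment_subset_of_mem hz hz').trans hab) (b - a))
    have h2 : n ^ 2 * M * ‖z' - z‖ ≤ l ^ 2 := by
      have h3 := (norm_sub_le_of_mem_segment hz hz').trans hδ
      rw [le_div_iff₀ (by positivity)] at h3
      nlinarith [norm_nonneg (z' - z)]
    have h4 := mul_le_mul_of_nonneg_right h2 (sq_nonneg ‖b - a‖)
    have h5 := hlow z (hab hz) (b - a)
    linarith
  obtain ⟨z, hz, hcost⟩ := stepCost_eq_quad hN hu (hab.trans hKN)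
  exact ⟨hab.trans hKN, hlow b (hab (right_mem_segment ℝ a b)),
    fun z' hz' => hcost ▸ hcomp z hz z' hz', hcost ▸ hlow z (hab hz) _,
    htaylor a b hab a (left_mem_segment ℝ a b), htaylor a b hab b (right_mem_segment ℝ a b)⟩

lemma GoodStep.isStep {l Λ : ℝ} {a b : Fin n → ℝ} (h : GoodStep u N l Λ a b) :
    IsStep u N a b (Real.sqrt (2 * stepCost u a b)) := by
  have h0 : 0 ≤ stepCost u a b := le_trans (by positivity) h.norm_le
  refine ⟨Real.sqrt_nonneg _, fun z hz => ⟨h.segment_subset hz, ?_⟩⟩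
  rw [Real.sq_sqrt (by positivity)]
  exact h.quad_le z hz

/-- Consecutive steps of a discrete geodesic have almost equal cost. -/
lemma GoodStep.abs_stepCost_sub_le {l Λ : ℝ} (hl : 0 < l) (hΛ : 0 ≤ Λ) (hN : IsOpen N)
    (hu : ContDiffOn ℝ (⊤ : ℕ∞) u N) {x y z : Fin n → ℝ}
    (h₁ : GoodStep u N l Λ x y) (h₂ : GoodStep u N l Λ y z)
    (h : coordGrad u y - coordGrad u x + hessian u y *ᵥ (y - x)
      = coordGrad u z - coordGrad u y + hessian u y *ᵥ (z - y)) :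
    |stepCost u y z - stepCost u x y|
      ≤ (n ^ 2 * Λ ^ 2 / l ^ 6) * (stepCost u x y + stepCost u y z) ^ 2 := by
  set G := hessian u y with hG
  set b := y - x with hb
  set a := z - y with ha
  set ρ := coordGrad u z - coordGrad u y - G *ᵥ a with hρ
  set σ := coordGrad u y - coordGrad u x - G *ᵥ b with hσ
  have hGab : (2 : ℝ) • (G *ᵥ (a - b)) = σ - ρ := by
    have e1 : coordGrad u y - coordGrad u x = σ + G *ᵥ b := by rw [hσ]; abel
    have e2 : coordGrad u z - coordGrad u y = ρ + G *ᵥ a := by rw [hρ]; abel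
    rw [e1, e2] at h
    rw [mulVec_sub, two_smul]
    linear_combination (exp := 1) -h
  have hsymm : ∀ w w' : Fin n → ℝ, w ⬝ᵥ (G *ᵥ w') = w' ⬝ᵥ (G *ᵥ w) := by
    have hGt : Gᵀ = G := by
      ext i j; exact hessian_symm hN hu (h₁.segment_subset (right_mem_segment ℝ x y)) j i
    intro w w'
    rw [dotProduct_mulVec, ← mulVec_transpose, hGt, dotProduct_comm]
  have hquad : 2 * quad u y (a - b) = (a - b) ⬝ᵥ (σ - ρ) := by
    rw [← hGab, dotProduct_smul, smul_eq_mul, quad]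
  have hdiff : stepCost u y z - stepCost u x y = (1 / 2) * ((a - b) ⬝ᵥ (σ + ρ)) := by
    have c1 : stepCost u y z = a ⬝ᵥ (G *ᵥ a) + a ⬝ᵥ ρ := by
      rw [stepCost, ← dotProduct_add, hρ, add_sub_cancel]
    have c2 : stepCost u x y = b ⬝ᵥ (G *ᵥ b) + b ⬝ᵥ σ := by
      rw [stepCost, ← dotProduct_add, hσ, add_sub_cancel]
    have k : (a + b) ⬝ᵥ ((2 : ℝ) • (G *ᵥ (a - b))) = (a + b) ⬝ᵥ (σ - ρ) := by rw [hGab]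
    simp only [dotProduct_smul, smul_eq_mul, mulVec_sub, dotProduct_sub, add_dotProduct] at k
    rw [c1, c2]
    simp only [sub_dotProduct, dotProduct_add]
    rw [hsymm b a] at k
    linarith
  have hρn : ‖ρ‖ ≤ Λ * ‖a‖ ^ 2 := h₂.taylor_left
  have hσn : ‖σ‖ ≤ Λ * ‖b‖ ^ 2 := h₁.taylor_right
  set e := ‖σ‖ + ‖ρ‖ with he
  have he0 : 0 ≤ e := by positivity
  have hab : l ^ 2 * ‖a - b‖ ≤ n * e := by
    have h1 : l ^ 2 * ‖a - b‖ ^ 2 ≤ n * ‖a - b‖ * e := by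
      have k1 := h₁.lower_right (a - b)
      have k2 := (le_abs_self _).trans (abs_dotProduct_le (a - b) (σ - ρ))
      have k3 : n * ‖a - b‖ * ‖σ - ρ‖ ≤ n * ‖a - b‖ * e := by gcongr; exact norm_sub_le σ ρ
      have k4 : 0 ≤ quad u y (a - b) := le_trans (by positivity) k1
      linarith
    rcases (norm_nonneg (a - b)).eq_or_lt with h0 | h0
    · rw [← h0]; simp; positivity
    · refine le_of_mul_le_mul_right ?_ h0
      nlinarith
  have hbound : |stepCost u y z - stepCost u x y| ≤ n ^ 2 / l ^ 2 * e ^ 2 := by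
    rw [hdiff, abs_mul, abs_of_pos (by norm_num : (0 : ℝ) < 1 / 2)]
    have k2 := abs_dotProduct_le (a - b) (σ + ρ)
    have k3 : n * ‖a - b‖ * ‖σ + ρ‖ ≤ n * ‖a - b‖ * e := by gcongr; exact norm_add_le σ ρ
    have k5 : ‖a - b‖ ≤ n * e / l ^ 2 := by rw [le_div_iff₀ (by positivity)]; linarith
    have k6 : n * ‖a - b‖ * e ≤ n * (n * e / l ^ 2) * e := by gcongr
    have k7 : n * (n * e / l ^ 2) * e = n ^ 2 / l ^ 2 * e ^ 2 := by ring
    linarith [abs_nonneg ((a - b) ⬝ᵥ (σ + ρ))]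
  have hen : l ^ 2 * e ≤ Λ * (stepCost u x y + stepCost u y z) := by
    have k1 := mul_le_mul_of_nonneg_left h₁.norm_le hΛ
    have k2 := mul_le_mul_of_nonneg_left h₂.norm_le hΛ
    have k3 := mul_le_mul_of_nonneg_left hρn (sq_nonneg l)
    have k4 := mul_le_mul_of_nonneg_left hσn (sq_nonneg l)
    rw [← hb] at k1; rw [← ha] at k2
    nlinarith
  have hen2 : e ^ 2 ≤ (Λ * (stepCost u x y + stepCost u y z)) ^ 2 / l ^ 4 := by
    rw [le_div_iff₀ (by positivity)]
    calc e ^ 2 * l ^ 4 = (l ^ 2 * e) ^ 2 := by ring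
      _ ≤ _ := pow_le_pow_left₀ (by positivity) hen 2
  calc _ ≤ n ^ 2 / l ^ 2 * e ^ 2 := hbound
    _ ≤ n ^ 2 / l ^ 2 * ((Λ * (stepCost u x y + stepCost u y z)) ^ 2 / l ^ 4) := by gcongr
    _ = _ := by field_simp

/-- The covector `Δy + g Δx` at the end of a short step has squared length close to `4` times
the cost. -/
lemma GoodStep.dual_norm_le {l Λ : ℝ} (hl : 0 < l)
    (hpos : ∀ x ∈ N, (hessian u x).PosDef) {a b : Fin n → ℝ}
    (h : GoodStep u N l Λ a b) {η : Fin n → ℝ}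
    (hη : η = coordGrad u b - coordGrad u a + hessian u b *ᵥ (b - a)) :
    η ⬝ᵥ (ginv u b *ᵥ η)
      ≤ 16 * stepCost u a b + (2 * n ^ 2 * Λ ^ 2 / l ^ 6) * stepCost u a b ^ 2 := by
  have hb : b ∈ N := h.segment_subset (right_mem_segment ℝ a b)
  set G := hessian u b with hG
  set d := b - a with hd
  set ρ := coordGrad u b - coordGrad u a - G *ᵥ d with hρ
  set ω := ginv u b *ᵥ ρ with hω
  have hGω : G *ᵥ ω = ρ := by
    rw [hω, mulVec_mulVec, hessian_mul_ginv hpos hb, one_mulVec]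
  have hηζ : η = G *ᵥ ((2 : ℝ) • d + ω) := by
    rw [mulVec_add, hGω, mulVec_smul, two_smul, hη, hρ]; abel
  have hval : η ⬝ᵥ (ginv u b *ᵥ η) = quad u b ((2 : ℝ) • d + ω) := by
    have : ginv u b *ᵥ η = (2 : ℝ) • d + ω := by
      rw [hηζ, mulVec_mulVec, ginv_mul_hessian hpos hb, one_mulVec]
    rw [this, dotProduct_comm, hηζ, quad]
  have hpar : quad u b ((2 : ℝ) • d + ω) + quad u b ((2 : ℝ) • d - ω)
      = 8 * quad u b d + 2 * quad u b ω := by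
    simp only [quad, mulVec_add, mulVec_sub, dotProduct_add, add_dotProduct, sub_dotProduct,
      dotProduct_sub, mulVec_smul, dotProduct_smul, smul_dotProduct, smul_eq_mul]
    ring
  have h0 := quad_nonneg hpos hb ((2 : ℝ) • d - ω)
  have hqd := h.quad_le b (right_mem_segment ℝ a b)
  have hωq : quad u b ω ≤ n ^ 2 * ‖ρ‖ ^ 2 / l ^ 2 := by
    have k0 : quad u b ω = ω ⬝ᵥ ρ := by rw [quad, ← hG, hGω]
    have k1 := h.lower_right ω
    have k2 : quad u b ω ≤ n * ‖ω‖ * ‖ρ‖ :=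
      k0 ▸ (le_abs_self _).trans (abs_dotProduct_le ω ρ)
    have k3 : ‖ω‖ ≤ n * ‖ρ‖ / l ^ 2 := by
      rw [le_div_iff₀ (by positivity)]
      rcases (norm_nonneg ω).eq_or_lt with h0 | h0
      · rw [← h0]; simp; positivity
      · refine le_of_mul_le_mul_right ?_ h0
        nlinarith
    calc quad u b ω ≤ n * ‖ω‖ * ‖ρ‖ := k2
      _ ≤ n * (n * ‖ρ‖ / l ^ 2) * ‖ρ‖ := by gcongr
      _ = _ := by ring
  have hρc : ‖ρ‖ ^ 2 ≤ Λ ^ 2 * stepCost u a b ^ 2 / l ^ 4 := by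
    have k1 : ‖ρ‖ ^ 2 ≤ (Λ * ‖d‖ ^ 2) ^ 2 := pow_le_pow_left₀ (norm_nonneg _) h.taylor_right 2
    have k2 : (l ^ 2 * ‖d‖ ^ 2) ^ 2 ≤ stepCost u a b ^ 2 :=
      pow_le_pow_left₀ (by positivity) h.norm_le 2
    rw [le_div_iff₀ (by positivity)]
    calc ‖ρ‖ ^ 2 * l ^ 4 ≤ (Λ * ‖d‖ ^ 2) ^ 2 * l ^ 4 := by gcongr
      _ = Λ ^ 2 * (l ^ 2 * ‖d‖ ^ 2) ^ 2 := by ring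
      _ ≤ _ := by gcongr
  have hω2 : quad u b ω ≤ (n ^ 2 * Λ ^ 2 / l ^ 6) * stepCost u a b ^ 2 := by
    calc quad u b ω ≤ n ^ 2 * ‖ρ‖ ^ 2 / l ^ 2 := hωq
      _ ≤ n ^ 2 * (Λ ^ 2 * stepCost u a b ^ 2 / l ^ 4) / l ^ 2 := by gcongr
      _ = _ := by field_simp
  have : (2 * n ^ 2 * Λ ^ 2 / l ^ 6) * stepCost u a b ^ 2
      = 2 * ((n ^ 2 * Λ ^ 2 / l ^ 6) * stepCost u a b ^ 2) := by ring
  rw [hval, this]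
  linarith

/-- A finite nonnegative sequence with quadratically small increments is nearly constant. -/
lemma le_of_small_increments {m : ℕ} {C S : ℝ} {c : ℕ → ℝ} (hc : ∀ k < m, 0 ≤ c k)
    (hC : 0 ≤ C) (hinc : ∀ k, k + 1 < m → |c (k + 1) - c k| ≤ C * (c k + c (k + 1)) ^ 2)
    (hS : ∑ k ∈ Finset.range m, c k ≤ S) (hsmall : 8 * C * S ≤ 1) :
    ∀ k < m, c k ≤ 2 * S / m := by
  intro k₀ hk₀
  have hm : 0 < m := by omega
  obtain ⟨i, hi, hmax⟩ := Finset.exists_max_image (Finset.range m) c ⟨k₀, by simpa using hk₀⟩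
  have him : i < m := Finset.mem_range.1 hi
  have hmax' : ∀ k < m, c k ≤ c i := fun k hk => hmax k (Finset.mem_range.2 hk)
  have hvar : ∀ p q, p ≤ q → q < m → |c q - c p| ≤ 4 * C * c i * S := by
    intro p q hpq hq
    have h1 := dist_le_Ico_sum_dist c hpq
    have h2 : ∀ k ∈ Finset.Ico p q, dist (c k) (c (k + 1)) ≤ 2 * C * c i * (c k + c (k + 1)) := by
      intro k hk
      have hk' := Finset.mem_Ico.1 hk
      have k0 := hc k (by omega)
      have k1 := hc (k + 1) (by omega)
      rw [dist_comm, Real.dist_eq]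
      refine (hinc k (by omega)).trans ?_
      have : c k + c (k + 1) ≤ 2 * c i := by
        linarith [hmax' k (by omega), hmax' (k + 1) (by omega)]
      have := mul_le_mul_of_nonneg_left this (mul_nonneg hC (add_nonneg k0 k1))
      linarith
    have h3 : ∑ k ∈ Finset.Ico p q, c k ≤ S :=
      (Finset.sum_le_sum_of_subset_of_nonneg (fun k hk => by
        have := Finset.mem_Ico.1 hk
        exact Finset.mem_range.2 (by omega)) fun k hk _ => hc k (Finset.mem_range.1 hk)).trans hS
    have h4 : ∑ k ∈ Finset.Ico p q, c (k + 1) ≤ S := by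
      rw [Finset.sum_Ico_add' c p q 1]
      exact (Finset.sum_le_sum_of_subset_of_nonneg (fun k hk => by
        have := Finset.mem_Ico.1 hk
        exact Finset.mem_range.2 (by omega)) fun k hk _ => hc k (Finset.mem_range.1 hk)).trans hS
    have h5 := Finset.sum_le_sum h2
    rw [← Finset.mul_sum, Finset.sum_add_distrib] at h5
    rw [← Real.dist_eq, dist_comm]
    have h6 : 0 ≤ 2 * C * c i := mul_nonneg (mul_nonneg two_pos.le hC) (hc i him)
    nlinarith [mul_le_mul_of_nonneg_left (add_le_add h3 h4) h6]
  have hhalf : ∀ k ∈ Finset.range m, c i / 2 ≤ c k := by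
    intro k hk
    have hkm := Finset.mem_range.1 hk
    have h1 : c i - c k ≤ 4 * C * c i * S := by
      rcases le_total k i with hki | hki
      · exact (le_abs_self _).trans (hvar k i hki him)
      · refine (le_abs_self _).trans ?_
        rw [abs_sub_comm]; exact hvar i k hki hkm
    have h2 := mul_le_mul_of_nonneg_right hsmall (hc i him)
    nlinarith
  have hsum := (Finset.card_nsmul_le_sum _ _ _ hhalf).trans hS
  rw [Finset.card_range, nsmul_eq_mul] at hsum
  refine (hmax' k₀ hk₀).trans ?_
  rw [le_div_iff₀ (by exact_mod_cast hm)]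
  linarith

end StepGeometry

section PathMaximizer

variable {N : Set (Fin n → ℝ)} {u F : (Fin n → ℝ) → ℝ} {m : ℕ} {x y : ℕ → Fin n → ℝ}
  {l Λ R : ℝ}

lemma energy_congr (h : ∀ k ≤ m, x k = y k) : energy u m x = energy u m y := by
  refine congrArg (fun s => (m : ℝ) * s) (Finset.sum_congr rfl fun k hk => ?_)
  have := Finset.mem_range.1 hk
  rw [h k (by omega), h (k + 1) (by omega)]

lemma continuousOn_energy (hN : IsOpen N) (hu : ContDiffOn ℝ (⊤ : ℕ∞) u N) :
    ContinuousOn (energy u m) {x | ∀ k, x k ∈ N} := by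
  have h : ∀ k p, ContinuousOn (fun x : ℕ → Fin n → ℝ => pd p u (x k)) {x | ∀ k, x k ∈ N} :=
    fun k p => (contDiffOn_pd hN hu p).continuousOn.comp (continuous_apply k).continuousOn
      fun x hx => hx k
  unfold energy
  simp only [stepCost, coordGrad, dotProduct, Pi.sub_apply]
  fun_prop

lemma GoodStep.stepCost_nonneg {a b : Fin n → ℝ} (h : GoodStep u N l Λ a b) :
    0 ≤ stepCost u a b :=
  le_trans (by positivity) h.norm_le

lemma reach_of_goodStep (h : ∀ k < m, GoodStep u N l Λ (x k) (x (k + 1))) :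
    ∀ k ≤ m, Reach u N (x 0) (x k) (∑ j ∈ Finset.range k, √(2 * stepCost u (x j) (x (j + 1)))) := by
  intro k
  induction k with
  | zero => intro _; exact .nil _ (by simp)
  | succ k ih =>
    intro hk
    rw [Finset.sum_range_succ]
    exact (ih (by omega)).trans (h k (by omega)).isStep.reach

lemma sum_sqrt_le_of_energy_le (h : ∀ k < m, GoodStep u N l Λ (x k) (x (k + 1)))
    (hR : 0 ≤ R) (hE : energy u m x ≤ R ^ 2) {k : ℕ} (hk : k ≤ m) :
    ∑ j ∈ Finset.range k, √(2 * stepCost u (x j) (x (j + 1))) ≤ 2 * R := by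
  refine (pow_le_pow_iff_left₀ (Finset.sum_nonneg fun _ _ => Real.sqrt_nonneg _)
    (by positivity) two_ne_zero).1 ?_
  have h0 : ∀ j ∈ Finset.range m, 0 ≤ √(2 * stepCost u (x j) (x (j + 1))) ^ 2 :=
    fun _ _ => sq_nonneg _
  calc _ ≤ (Finset.range k).card * ∑ j ∈ Finset.range k,
        √(2 * stepCost u (x j) (x (j + 1))) ^ 2 := sq_sum_le_card_mul_sum_sq
    _ ≤ m * ∑ j ∈ Finset.range m, √(2 * stepCost u (x j) (x (j + 1))) ^ 2 := by
        rw [Finset.card_range]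
        gcongr
    _ = 2 * energy u m x := by
        rw [energy, mul_left_comm]
        congr 1
        rw [Finset.mul_sum]
        refine Finset.sum_congr rfl fun j hj => Real.sq_sqrt ?_
        linarith [(h j (Finset.mem_range.1 hj)).stepCost_nonneg]
    _ ≤ (2 * R) ^ 2 := by nlinarith

/-- A maximizer over discrete paths that stay strictly inside the constraints is a local
maximizer along every line. -/
lemma isPathMax_of_isMaxOn (hN : IsOpen N) (hu : ContDiffOn ℝ (⊤ : ℕ∞) u N)
    {U K : Set (Fin n → ℝ)} (hU : IsOpen U) (hUK : U ⊆ K) (hKN : K ⊆ N) {p : Fin n → ℝ}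
    {δ B : ℝ} (hδ : 0 ≤ δ)
    (hmax : IsMaxOn (fun x => F (x m) * (max (B - energy u m x) 0) ^ 2)
      {x | (∀ k, x k ∈ K) ∧ x 0 = p ∧ ∀ k, ‖x (k + 1) - x k‖ ≤ δ} x)
    (hx0 : x 0 = p) (hxU : ∀ k ≤ m, x k ∈ U) (hstep : ∀ k < m, ‖x (k + 1) - x k‖ < δ)
    (hB : 0 < B - energy u m x) : IsPathMax u F m B x := by
  intro V hV
  have hxN : ∀ k ≤ m, x k + (0 : ℝ) • V k ∈ N := fun k hk => by
    simpa using hKN (hUK (hxU k hk))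
  have hE : ∀ᶠ t in 𝓝 (0 : ℝ), 0 < B - energy u m (x + t • V) := by
    have hc := (hasDerivAt_energy hN hu x V hxN).continuousAt
    have : ContinuousAt (fun t : ℝ => B - energy u m (x + t • V)) 0 := continuousAt_const.sub hc
    refine this.eventually (lt_mem_nhds ?_)
    simpa using hB
  have hS : ∀ᶠ t in 𝓝 (0 : ℝ), ∀ k ∈ Finset.range m,
      ‖(x (k + 1) + t • V (k + 1)) - (x k + t • V k)‖ < δ := by
    rw [Filter.eventually_all_finset]
    intro k hk
    have hc : ContinuousAt (fun t : ℝ => ‖(x (k + 1) + t • V (k + 1)) - (x k + t • V k)‖) 0 := by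
      fun_prop
    refine hc.eventually (gt_mem_nhds ?_)
    simpa using hstep k (Finset.mem_range.1 hk)
  filter_upwards [hE, hS, eventually_line_mem hU V hxU] with t h1 h2 h3
  set y : ℕ → Fin n → ℝ := fun k => x (min k m) + t • V (min k m) with hy
  have hye : energy u m y = energy u m (x + t • V) := energy_congr fun k hk => by
    simp [hy, min_eq_left hk]
  have hyD : y ∈ {x | (∀ k, x k ∈ K) ∧ x 0 = p ∧ ∀ k, ‖x (k + 1) - x k‖ ≤ δ} := by
    refine ⟨fun k => hUK (h3 _ (min_le_right k m)), by simp [hy, hV, hx0], fun k => ?_⟩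
    rcases lt_or_ge k m with hk | hk
    · simp only [hy, min_eq_left hk.le, min_eq_left (Nat.succ_le_of_lt hk)]
      exact (h2 k (Finset.mem_range.2 hk)).le
    · simp [hy, min_eq_right hk, min_eq_right (hk.trans (Nat.le_succ k)), hδ]
  have := hmax hyD
  simp only [Set.mem_ofPred_eq, hye, max_eq_left h1.le, max_eq_left hB.le] at this
  simpa [hy] using this

lemma exists_pathMax (hN : IsOpen N) (hu : ContDiffOn ℝ (⊤ : ℕ∞) u N)
    (hpos : ∀ x ∈ N, (hessian u x).PosDef) (hcomplete : HessComplete u N)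
    (hF : ContDiffOn ℝ (⊤ : ℕ∞) F N) {p : Fin n → ℝ} (hp : p ∈ N) (hFp : 0 < F p) (hR : 0 < R) :
    ∃ l > 0, ∃ Λ ≥ 0, ∃ m₀ : ℕ, ∀ m ≥ m₀, ∃ x : ℕ → Fin n → ℝ, (∀ k, x k ∈ N) ∧ x 0 = p ∧
      (∀ k < m, GoodStep u N l Λ (x k) (x (k + 1))) ∧ 0 < R ^ 2 - energy u m x ∧ 0 < F (x m) ∧
      F p * R ^ 4 ≤ F (x m) * (R ^ 2 - energy u m x) ^ 2 ∧ IsPathMax u F m (R ^ 2) x := by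
  obtain ⟨K, hK, hKN, hreach⟩ := confined_of_complete hN hu hpos hcomplete hp (2 * R)
  obtain ⟨δ₀, hδ₀, hsub⟩ := hK.exists_cthickening_subset_open hN hKN
  obtain ⟨l, hl, Λ, hΛ, δ₁, hδ₁, hgood⟩ :=
    exists_goodStep hN hu hpos (hK.cthickening (r := δ₀)) hsub
  set K₁ := Metric.cthickening (δ₀ / 2) K with hK₁
  have hK₁K₂ : K₁ ⊆ Metric.cthickening δ₀ K := Metric.cthickening_mono (by linarith) K
  have hK₁N : K₁ ⊆ N := hK₁K₂.trans hsub
  set δ := min δ₁ (δ₀ / 2) with hδ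
  have hδ0 : 0 < δ := lt_min hδ₁ (by linarith)
  have hstep : ∀ a b, a ∈ K₁ → ‖b - a‖ ≤ δ → GoodStep u N l Λ a b := by
    intro a b ha hab
    refine hgood a b ?_ (hab.trans (min_le_left _ _))
    have h1 : Metric.closedBall a (δ₀ / 2) ⊆ Metric.cthickening δ₀ K := by
      refine (Metric.closedBall_subset_cthickening ha (δ₀ / 2)).trans ?_
      refine (Metric.cthickening_cthickening_subset (by linarith) (by linarith) K).trans ?_
      rw [add_halves]
    refine ((convex_closedBall a (δ₀ / 2)).segment_subset
      (Metric.mem_closedBall_self (by linarith)) ?_).trans h1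
    rw [mem_closedBall_iff_norm]
    exact hab.trans (min_le_right _ _)
  obtain ⟨m₀, hm₀⟩ := exists_nat_gt (R ^ 2 / (l ^ 2 * δ ^ 2))
  refine ⟨l, hl, Λ, hΛ, m₀, fun m hm => ?_⟩
  have hmR : R ^ 2 < m * (l ^ 2 * δ ^ 2) := by
    rw [← div_lt_iff₀ (by positivity)]
    exact hm₀.trans_le (by exact_mod_cast hm)
  set D : Set (ℕ → Fin n → ℝ) :=
    {x | (∀ k, x k ∈ K₁) ∧ x 0 = p ∧ ∀ k, ‖x (k + 1) - x k‖ ≤ δ} with hD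
  have hDc : IsCompact D := by
    have h1 : IsCompact (Set.univ.pi fun _ : ℕ => K₁) :=
      isCompact_univ_pi fun _ => hK.cthickening
    refine h1.of_isClosed_subset ?_ fun x hx k _ => hx.1 k
    have h2 : IsClosed K₁ := Metric.isClosed_cthickening
    simp only [hD, Set.ofPred_and, Set.ofPred_forall]
    refine (isClosed_iInter fun k => h2.preimage (continuous_apply k)).inter
      (IsClosed.inter (isClosed_eq (continuous_apply 0) continuous_const)
        (isClosed_iInter fun k => isClosed_le (by fun_prop) continuous_const))
  have hpD : (fun _ => p) ∈ D := by
    refine ⟨fun _ => Metric.self_subset_cthickening K (hreach p (.nil p (by positivity))), rfl,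
      fun _ => by simp [hδ0.le]⟩
  have hcont : ContinuousOn (fun x => F (x m) * (max (R ^ 2 - energy u m x) 0) ^ 2) D := by
    have h1 : ContinuousOn (fun x : ℕ → Fin n → ℝ => F (x m)) D :=
      hF.continuousOn.comp (continuous_apply m).continuousOn fun x hx => hK₁N (hx.1 m)
    have h2 : ContinuousOn (energy u m) D :=
      (continuousOn_energy hN hu).mono fun x hx k => hK₁N (hx.1 k)
    exact h1.mul (((continuousOn_const.sub h2).sup continuousOn_const).pow 2)
  obtain ⟨x, hxD, hmax⟩ := hDc.exists_isMaxOn ⟨_, hpD⟩ hcont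
  have hval : F p * R ^ 4 ≤ F (x m) * (max (R ^ 2 - energy u m x) 0) ^ 2 := by
    have := hmax hpD
    simp only [Set.mem_ofPred_eq, energy, stepCost, sub_self, zero_dotProduct,
      Finset.sum_const_zero, mul_zero, sub_zero, max_eq_left (sq_nonneg R)] at this
    rw [show R ^ 4 = (R ^ 2) ^ 2 by ring]
    exact this
  have hval0 : 0 < F p * R ^ 4 := by positivity
  have hE : 0 < R ^ 2 - energy u m x := by
    by_contra! hneg
    rw [max_eq_right hneg] at hval
    simp at hval
    linarith
  rw [max_eq_left hE.le] at hval
  have hFm : 0 < F (x m) :=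
    pos_of_mul_pos_left (hval0.trans_le hval) (sq_nonneg _)
  have hgs : ∀ k < m, GoodStep u N l Λ (x k) (x (k + 1)) := fun k _ =>
    hstep _ _ (hxD.1 k) (hxD.2.2 k)
  refine ⟨x, fun k => hK₁N (hxD.1 k), hxD.2.1, hgs, hE, hFm, hval,
    isPathMax_of_isMaxOn hN hu Metric.isOpen_thickening
      (Metric.thickening_subset_cthickening (δ₀ / 2) K) hK₁N hδ0.le hmax hxD.2.1 ?_ ?_ hE⟩
  · intro k hk
    refine Metric.self_subset_thickening (by linarith) K (hreach _ ?_)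
    have := reach_of_goodStep hgs k hk
    rw [hxD.2.1] at this
    exact this.mono (sum_sqrt_le_of_energy_le hgs hR.le (by linarith) hk)
  · intro k hk
    have h1 : (m : ℝ) * stepCost u (x k) (x (k + 1)) ≤ energy u m x :=
      mul_le_mul_of_nonneg_left (Finset.single_le_sum
        (f := fun k => stepCost u (x k) (x (k + 1)))
        (fun j hj => (hgs j (Finset.mem_range.1 hj)).stepCost_nonneg)
        (Finset.mem_range.2 hk)) (Nat.cast_nonneg m)
    have h2 := mul_le_mul_of_nonneg_left (hgs k hk).norm_le (Nat.cast_nonneg (α := ℝ) m)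
    have hm0 : (0 : ℝ) < m * l ^ 2 := by
      have : 0 < m := by omega
      positivity
    have h3 : ‖x (k + 1) - x k‖ ^ 2 < δ ^ 2 := by
      refine lt_of_mul_lt_mul_left (a := (m : ℝ) * l ^ 2) ?_ hm0.le
      linarith
    exact (pow_lt_pow_iff_left₀ (norm_nonneg _) hδ0.le two_ne_zero).1 h3

end PathMaximizer

section Estimate

variable {N : Set (Fin n → ℝ)} {u F : (Fin n → ℝ) → ℝ} {m : ℕ} {x : ℕ → Fin n → ℝ}
  {v ξ : Fin n → ℝ} {c l Λ R : ℝ}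

lemma sum_cutoff_le {j : ℕ} (hj : 0 < j) (hjm : j ≤ m) {a C : ℝ} {D : ℕ → ℝ}
    (hD : ∀ k < j, |D k| ≤ C) :
    ∑ k ∈ Finset.range m, (a * (min 1 ((k + 1 : ℕ) / j : ℝ) - min 1 (k / j : ℝ)) ^ 2
      - (min 1 ((k + 1 : ℕ) / j : ℝ) ^ 2 - min 1 (k / j : ℝ) ^ 2) * D k) ≤ a / j + 2 * C := by
  have hj0 : (0 : ℝ) < j := by exact_mod_cast hj
  rw [← Finset.sum_subset (Finset.range_subset_range.2 hjm)]
  · have hterm : ∀ k ∈ Finset.range j,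
        a * (min 1 ((k + 1 : ℕ) / j : ℝ) - min 1 (k / j : ℝ)) ^ 2
        - (min 1 ((k + 1 : ℕ) / j : ℝ) ^ 2 - min 1 (k / j : ℝ) ^ 2) * D k
        ≤ a / j ^ 2 + 2 * C / j := by
      intro k hk
      have hk' := Finset.mem_range.1 hk
      have h1 : ((k + 1 : ℕ) : ℝ) / j ≤ 1 := by
        rw [div_le_one hj0]; exact_mod_cast hk'
      have h2 : (k : ℝ) / j ≤ 1 := by
        rw [div_le_one hj0]; exact_mod_cast hk'.le
      rw [min_eq_right h1, min_eq_right h2]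
      set s := (k : ℝ) / j with hs
      have hs0 : 0 ≤ s := by positivity
      have hs1 : ((k + 1 : ℕ) : ℝ) / j = s + 1 / j := by push_cast; rw [add_div]
      rw [hs1] at h1 ⊢
      have e : a * (s + 1 / j - s) ^ 2 - ((s + 1 / j) ^ 2 - s ^ 2) * D k
          = a / j ^ 2 + 1 / j * ((s + 1 / j) + s) * (-D k) := by ring
      rw [e]
      have hDk := hD k hk'
      have hC := (abs_nonneg _).trans hDk
      have h3 : 1 / j * ((s + 1 / j) + s) * (-D k) ≤ 1 / j * 2 * C := by
        refine mul_le_mul_of_nonneg (mul_le_mul_of_nonneg_left (by linarith) (by positivity))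
          ((neg_le_abs _).trans hDk) (by positivity) hC
      calc _ ≤ a / j ^ 2 + 1 / j * 2 * C := by linarith
        _ = _ := by ring
    refine (Finset.sum_le_card_nsmul _ _ _ hterm).trans_eq ?_
    rw [Finset.card_range, nsmul_eq_mul]
    field_simp
  · intro k _ hk
    have hk' : j ≤ k := by simpa using hk
    have h1 : 1 ≤ (k : ℝ) / j := by
      rw [one_le_div hj0]; exact_mod_cast hk'
    have h2 : 1 ≤ ((k + 1 : ℕ) : ℝ) / j := by
      rw [one_le_div hj0]; exact_mod_cast hk'.trans (Nat.le_succ k)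
    rw [min_eq_left h1, min_eq_left h2]
    ring

/-- A discrete geodesic with enough steps is traversed at almost constant speed. -/
lemma IsPathMax.stepCost_le (hN : IsOpen N) (hu : ContDiffOn ℝ (⊤ : ℕ∞) u N)
    (hF : ContDiffOn ℝ (⊤ : ℕ∞) F N) (hmax : IsPathMax u F m (R ^ 2) x) (hx : ∀ k, x k ∈ N)
    (hE : 0 < R ^ 2 - energy u m x) (hFm : 0 < F (x m)) (hl : 0 < l) (hΛ : 0 ≤ Λ)
    (hgood : ∀ k < m, GoodStep u N l Λ (x k) (x (k + 1))) (hm : 0 < m)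
    (hmR : 8 * (n ^ 2 * Λ ^ 2 / l ^ 6) * R ^ 2 ≤ m) :
    ∀ k < m, stepCost u (x k) (x (k + 1)) ≤ 2 * R ^ 2 / m ^ 2 := by
  have hm0 : (0 : ℝ) < m := by exact_mod_cast hm
  have := le_of_small_increments (m := m) (C := n ^ 2 * Λ ^ 2 / l ^ 6) (S := R ^ 2 / m)
    (c := fun k => stepCost u (x k) (x (k + 1))) (fun k hk => (hgood k hk).stepCost_nonneg)
    (by positivity)
    (fun k hk => (hgood k (by omega)).abs_stepCost_sub_le hl hΛ hN hu (hgood (k + 1) hk)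
      (hmax.interior hN hu hF (fun k _ => hx k) hE hFm hk))
    (by rw [le_div_iff₀ hm0, mul_comm]; exact (sub_pos.1 hE).le)
    (by rw [← mul_div_assoc, div_le_one hm0]; exact hmR)
  intro k hk
  refine (this k hk).trans_eq ?_
  field_simp

lemma sqrt_stepCost_le {s : ℝ} (hR : 0 ≤ R) (hs : s ≤ 2 * R ^ 2 / m ^ 2) :
    √(2 * s) ≤ 2 * R / m := by
  refine Real.sqrt_le_iff.2 ⟨by positivity, ?_⟩
  calc 2 * s ≤ 2 * (2 * R ^ 2 / m ^ 2) := by linarith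
    _ = _ := by ring

/-- Cubic growth bound for the maximum of the localized functional. -/
lemma exists_growth_bound (hN : IsOpen N) (hu : ContDiffOn ℝ (⊤ : ℕ∞) u N)
    (hpos : ∀ x ∈ N, (hessian u x).PosDef) (hMA : MAeq u N v ξ c) (hcomplete : HessComplete u N)
    (hF : ContDiffOn ℝ (⊤ : ℕ∞) F N)
    (hineq : ∀ x ∈ N, driftLap u (weight u ξ v) F x ≥ (F x) ^ 2)
    {p : Fin n → ℝ} (hp : p ∈ N) (hFp : 0 < F p) :
    ∃ C, ∀ R : ℝ, 1 ≤ R → F p * R ^ 4 ≤ C * R ^ 3 := by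
  obtain ⟨r, hr, hball⟩ := Metric.nhds_basis_closedBall.mem_iff.1 (hN.mem_nhds hp)
  obtain ⟨lam, hlam, hlow⟩ := exists_quad_lower hN hu hpos (isCompact_closedBall p r) hball
  have hψ : ContDiffOn ℝ (⊤ : ℕ∞) (fun y => v ⬝ᵥ y + ξ ⬝ᵥ coordGrad u y) N := by
    refine ContDiffOn.add (ContDiffOn.sum fun i _ => ?_)
      (ContDiffOn.sum fun i _ => contDiffOn_const.mul (contDiffOn_pd hN hu i))
    exact contDiffOn_const.mul (contDiff_apply ℝ ℝ i).contDiffOn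
  obtain ⟨L, hL, hlip⟩ := exists_lipschitz_on_segments hN hψ (isCompact_closedBall p r) hball
  set C₁ := 2 * n * (2 / (lam * r) + 2) + 8 * L / lam with hC₁
  have hC₁0 : 0 ≤ C₁ := by positivity
  refine ⟨198 + 2 * C₁, fun R hR => ?_⟩
  have hR0 : 0 < R := by linarith
  obtain ⟨l, hl, Λ, hΛ, m₀, hm₀⟩ := exists_pathMax hN hu hpos hcomplete hF hp hFp hR0
  set A := (n : ℝ) ^ 2 * Λ ^ 2 / l ^ 6 with hA
  have hA0 : 0 ≤ A := by positivity
  obtain ⟨j₀, hj₀⟩ := exists_nat_ge (8 * A * R ^ 2)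
  set j := max m₀ j₀ + 1 with hj
  set M := ⌈2 * R / (lam * r)⌉₊ + 1 with hM
  set m := M * j with hm
  have hjpos : 0 < j := Nat.succ_pos _
  have hMpos : 0 < M := Nat.succ_pos _
  have hjm : j ≤ m := Nat.le_mul_of_pos_left j hMpos
  have hmpos : 0 < m := Nat.mul_pos hMpos hjpos
  have hmge : m₀ ≤ m := le_trans (by omega) hjm
  have hmR : 8 * A * R ^ 2 ≤ m := hj₀.trans (by exact_mod_cast le_trans (by omega) hjm)
  obtain ⟨x, hx, hx0, hgood, hE, hFm, hval, hmax⟩ := hm₀ m hmge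
  have hj0 : (0 : ℝ) < j := by exact_mod_cast hjpos
  have hM0 : (0 : ℝ) < M := by exact_mod_cast hMpos
  have hm0 : (0 : ℝ) < m := by exact_mod_cast hmpos
  have hm1 : (1 : ℝ) ≤ m := by exact_mod_cast hmpos
  have hmMj : (m : ℝ) = M * j := by rw [hm]; push_cast; ring
  have hMlow : 2 * R / (lam * r) ≤ M := by
    rw [hM]; push_cast
    linarith [Nat.le_ceil (2 * R / (lam * r))]
  have hMup : (M : ℝ) ≤ (2 / (lam * r) + 2) * R := by
    rw [hM]; push_cast
    have h1 := Nat.ceil_lt_add_one (a := 2 * R / (lam * r)) (by positivity)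
    have h2 : 2 / (lam * r) * R = 2 * R / (lam * r) := by ring
    linarith
  have hE0 : 0 ≤ energy u m x := mul_nonneg hm0.le
    (Finset.sum_nonneg fun k hk => (hgood k (Finset.mem_range.1 hk)).stepCost_nonneg)
  have hcost := hmax.stepCost_le hN hu hF hx hE hFm hl hΛ hgood hmpos hmR
  have hreach : ∀ k ≤ j, x k ∈ Metric.closedBall p r := by
    intro k hk
    have h1 := reach_of_goodStep hgood k (hk.trans hjm)
    rw [hx0] at h1
    refine h1.mem_closedBall hlam hlow ?_ subset_rfl
    calc _ ≤ ∑ _i ∈ Finset.range k, 2 * R / m := Finset.sum_le_sum fun i hi =>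
          sqrt_stepCost_le hR0.le (hcost i (by have := Finset.mem_range.1 hi; omega))
      _ = k * (2 * R / m) := by simp
      _ ≤ j * (2 * R / m) := by gcongr
      _ = 2 * R / M := by rw [hmMj]; field_simp
      _ ≤ lam * r := by
        rw [div_le_iff₀ hM0]
        rw [div_le_iff₀ (by positivity)] at hMlow
        linarith
  have hdrift : ∀ k < j, |v ⬝ᵥ (x (k + 1) - x k)
      + ξ ⬝ᵥ (coordGrad u (x (k + 1)) - coordGrad u (x k))| ≤ L * (2 * R / (lam * m)) := by
    intro k hk
    have hkm : k < m := by omega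
    have h1 : lam ^ 2 * ‖x (k + 1) - x k‖ ^ 2 ≤ (2 * R / m) ^ 2 := by
      have h2 := hlow (x k) (hreach k hk.le) (x (k + 1) - x k)
      have h3 := (hgood k hkm).quad_le _ (left_mem_segment ℝ _ _)
      have h4 : (2 * R / m) ^ 2 = 2 * (2 * R ^ 2 / m ^ 2) := by ring
      linarith [hcost k hkm]
    rw [← mul_pow] at h1
    have h2 : lam * ‖x (k + 1) - x k‖ ≤ 2 * R / m :=
      (pow_le_pow_iff_left₀ (by positivity) (by positivity) two_ne_zero).1 h1
    have h3 : ‖x (k + 1) - x k‖ ≤ 2 * R / (lam * m) := by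
      rw [mul_comm lam, ← div_div, le_div_iff₀ hlam]; linarith
    have h4 := hlip _ _ ((convex_closedBall p r).segment_subset (hreach k hk.le)
      (hreach (k + 1) hk))
    rw [dotProduct_sub, dotProduct_sub]
    refine le_trans (le_of_eq ?_) (h4.trans (mul_le_mul_of_nonneg_left h3 hL))
    congr 1; ring
  set f : ℕ → ℝ := fun k => min 1 ((k : ℝ) / j) with hf
  have hmain := hmax.main_inequality hN hu hpos hMA hF hineq hx hmpos hE hFm (f := f)
    (fun k => le_min zero_le_one (by positivity)) (by simp [hf])
    (min_eq_left (by rw [one_le_div hj0]; exact_mod_cast hjm)) rfl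
  have hT := mul_le_mul_of_nonneg_left
    (sum_cutoff_le hjpos hjm (a := 2 * n) hdrift) hm0.le
  have hTR : (m : ℝ) * (2 * n / j + 2 * (L * (2 * R / (lam * m)))) ≤ C₁ * R := by
    have e : (m : ℝ) * (2 * n / j + 2 * (L * (2 * R / (lam * m))))
        = 2 * n * M + 4 * L / lam * R := by
      rw [hmMj]; field_simp; ring
    rw [e, hC₁, add_mul, mul_assoc (2 * (n : ℝ))]
    gcongr
    norm_num
  have hη : (m : ℝ) ^ 2 * ((coordGrad u (x m) - coordGrad u (x (m - 1))
      + hessian u (x m) *ᵥ (x m - x (m - 1))) ⬝ᵥ (ginv u (x m) *ᵥ (coordGrad u (x m)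
        - coordGrad u (x (m - 1)) + hessian u (x m) *ᵥ (x m - x (m - 1))))) ≤ 33 * R ^ 2 := by
    have hlt : m - 1 < m := by omega
    have hg := hgood (m - 1) hlt
    have hc := hcost (m - 1) hlt
    have hc0 := hg.stepCost_nonneg
    rw [Nat.sub_add_cancel hmpos] at hg hc hc0
    have h1 := hg.dual_norm_le hl hpos rfl
    set s := stepCost u (x (m - 1)) (x m) with hs
    have h2 : (m : ℝ) ^ 2 * s ≤ 2 * R ^ 2 := by
      rw [le_div_iff₀ (by positivity)] at hc; linarith
    have h3 : 2 * (n : ℝ) ^ 2 * Λ ^ 2 / l ^ 6 = 2 * A := by rw [hA]; ring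
    rw [h3] at h1
    have h4 : 8 * A * s ≤ 2 := by
      have k1 := mul_le_mul_of_nonneg_right hmR hc0
      have k2 : R ^ 2 * (8 * A * s) ≤ R ^ 2 * 2 := by nlinarith
      exact le_of_mul_le_mul_left k2 (by positivity)
    refine (mul_le_mul_of_nonneg_left h1 (sq_nonneg (m : ℝ))).trans ?_
    have h5 := mul_le_mul_of_nonneg_left h4 (mul_nonneg (sq_nonneg (m : ℝ)) hc0)
    have h6 : (m : ℝ) ^ 2 * (16 * s + 2 * A * s ^ 2)
        = 16 * ((m : ℝ) ^ 2 * s) + (m : ℝ) ^ 2 * s * (8 * A * s) / 4 := by ring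
    rw [h6]
    linarith
  have h1 := mul_le_mul_of_nonneg_left (hT.trans hTR) hE.le
  have h2 : (R ^ 2 - energy u m x) * (C₁ * R) ≤ R ^ 2 * (C₁ * R) :=
    mul_le_mul_of_nonneg_right (by linarith) (by positivity)
  have h3 : R ^ 2 ≤ R ^ 3 := pow_le_pow_right₀ hR (by norm_num)
  linarith

end Estimate

theorem liouville_complete_hessian {n : ℕ} (hn : 1 ≤ n) (N : Set (Fin n → ℝ)) (hNopen : IsOpen N)
    (hNne : N.Nonempty) (u : (Fin n → ℝ) → ℝ) (hu : ContDiffOn ℝ (⊤ : ℕ∞) u N)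
    (hpos : ∀ x ∈ N, (hessian u x).PosDef)
    (v ξ : Fin n → ℝ) (c : ℝ) (hMA : MAeq u N v ξ c) (hcomplete : HessComplete u N)
    (F : (Fin n → ℝ) → ℝ) (hF : ContDiffOn ℝ (⊤ : ℕ∞) F N) (hFnonneg : ∀ x ∈ N, 0 ≤ F x)
    (hineq : ∀ x ∈ N, driftLap u (weight u ξ v) F x ≥ (F x)^2) :
    ∀ x ∈ N, F x = 0 := by
  intro p hp
  by_contra hne
  have hFp : 0 < F p := lt_of_le_of_ne (hFnonneg p hp) (Ne.symm hne)
  obtain ⟨C, hC⟩ := exists_growth_bound hNopen hu hpos hMA hcomplete hF hineq hp hFp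
  obtain ⟨R, hR⟩ := exists_gt (max 1 (C / F p))
  have hR1 : 1 < R := (le_max_left _ _).trans_lt hR
  have hRC : C < R * F p := by
    rw [← div_lt_iff₀ hFp]; exact (le_max_right _ _).trans_lt hR
  have h1 := hC R hR1.le
  have h2 : C * R ^ 3 < R * F p * R ^ 3 := mul_lt_mul_of_pos_right hRC (by positivity)
  linarith

end KRS
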